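/- (First radial eigenvalues in the ball.) Assume 𝓕 satisfies (F1), (F2) and (F3). For R' ∈ (0,R], consider the radial eigenvalue problem 𝓕(u''(r), u'(r)/r, u'(r), u(r), r) = −μ·u(r) on (0,R'), u'(0) = 0, u(R') = 0, for u ∈ C²(0,R') ∩ C¹([0,R']). Then for every R' ∈ (0,R]: (existence) there exist real numbers λ⁺(R'), λ⁻(R') and solutions u⁺ > 0 and u⁻ < 0 on [0,R') with eigenvalues λ⁺(R') and λ⁻(R') respectively; (i) λ⁺(R') ≤ λ⁻(R'); (ii) every solution pair (μ,v) with v > 0 (resp. v < 0) on (0,R') satisfies μ = λ⁺(R') (resp. μ = λ⁻(R')) and v is a positive scalar multiple of u⁺ (resp. of u⁻); (iii) if 0 < R'' < R' ≤ R then λ⁺(R') < λ⁺(R'') and λ⁻(R') < λ⁻(R''); (iv) λ⁺(R') → +∞ and λ⁻(R') → +∞ as R' → 0⁺. -/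

import Mathlib

open Set

/-- The radial Pucci-type maximal operator `P⁺(x,y) = Λ(x⁺+(N-1)y⁺) - λ(x⁻+(N-1)y⁻)`. -/
noncomputable def Pplus (N : ℕ) (lam Lam : ℝ) (x y : ℝ) : ℝ :=
  Lam * (max x 0 + ((N : ℝ) - 1) * max y 0) - lam * (max (-x) 0 + ((N : ℝ) - 1) * max (-y) 0)

/-- The radial Pucci-type minimal operator `P⁻(x,y) = λ(x⁺+(N-1)y⁺) - Λ(x⁻+(N-1)y⁻)`. -/
noncomputable def Pminus (N : ℕ) (lam Lam : ℝ) (x y : ℝ) : ℝ :=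
  lam * (max x 0 + ((N : ℝ) - 1) * max y 0) - Lam * (max (-x) 0 + ((N : ℝ) - 1) * max (-y) 0)

/-- `u ∈ C²(e,R) ∩ C¹([e,R])`, with first derivative `u'` (one-sided at the endpoints)
and second derivative `u''` on the open interval. -/
def RadC2 (e R : ℝ) (u u' u'' : ℝ → ℝ) : Prop :=
  (∀ r ∈ Set.Icc e R, HasDerivWithinAt u (u' r) (Set.Icc e R) r) ∧
  ContinuousOn u' (Set.Icc e R) ∧
  (∀ r ∈ Set.Ioo e R, HasDerivAt u' (u'' r) r) ∧
  ContinuousOn u'' (Set.Ioo e R)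

/-- `(μ,u)` is a radial eigenpair on the ball of radius `R'`. -/
def RadEigenSol (FF : ℝ → ℝ → ℝ → ℝ → ℝ → ℝ) (R' μ : ℝ) (u u' u'' : ℝ → ℝ) : Prop :=
  RadC2 0 R' u u' u'' ∧
  (∀ r ∈ Set.Ioo (0 : ℝ) R', FF (u'' r) (u' r / r) (u' r) (u r) r = -μ * u r) ∧
  u' 0 = 0 ∧ u R' = 0

/-- The structural assumptions (homogeneity, uniform ellipticity and continuity) on a radial operator
whose coefficients are defined for all real radii. -/
structure RadialOperator (N : ℕ) (lam Lam gam del : ℝ) (F : ℝ → ℝ → ℝ → ℝ → ℝ → ℝ) : Prop where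
  one_le : 1 ≤ N
  lam_pos : 0 < lam
  lam_le : lam ≤ Lam
  gam_pos : 0 < gam
  del_pos : 0 < del
  cont : Continuous (fun z : ℝ × ℝ × ℝ × ℝ × ℝ => F z.1 z.2.1 z.2.2.1 z.2.2.2.1 z.2.2.2.2)
  homog : ∀ s : ℝ, 0 ≤ s → ∀ m l p u r : ℝ, F (s * m) (s * l) (s * p) (s * u) r = s * F m l p u r
  lower : ∀ m l p u m' l' p' u' r : ℝ,
    Pminus N lam Lam (m - m') (l - l') - gam * |p - p'| - del * |u - u'|
      ≤ F m l p u r - F m' l' p' u' r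
  upper : ∀ m l p u m' l' p' u' r : ℝ,
    F m l p u r - F m' l' p' u' r
      ≤ Pplus N lam Lam (m - m') (l - l') + gam * |p - p'| + del * |u - u'|

section Pucci

variable {N : ℕ} {lam Lam m l : ℝ}

theorem Pplus_neg : Pplus N lam Lam (-m) (-l) = -Pminus N lam Lam m l := by
  simp only [Pminus, Pplus, neg_neg]; ring

theorem Pplus_le_of_nonpos (hN : 1 ≤ N) (hlam : 0 < lam) (hm : m ≤ 0) (hl : l ≤ 0) :
    Pplus N lam Lam m l ≤ lam * m := by
  have hn : (0 : ℝ) ≤ (N : ℝ) - 1 := by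
    have : (1 : ℝ) ≤ N := by exact_mod_cast hN
    linarith
  rw [Pplus, max_eq_right hm, max_eq_right hl, max_eq_left (by linarith : 0 ≤ -m),
    max_eq_left (by linarith : 0 ≤ -l)]
  nlinarith [mul_nonneg hlam.le (mul_nonneg hn (by linarith : 0 ≤ -l))]

theorem le_Pminus_of_nonneg (hN : 1 ≤ N) (hlam : 0 < lam) (hm : 0 ≤ m) (hl : 0 ≤ l) :
    lam * m ≤ Pminus N lam Lam m l := by
  have := Pplus_le_of_nonpos (Lam := Lam) hN hlam (neg_nonpos.2 hm) (neg_nonpos.2 hl)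
  rw [Pplus_neg] at this
  linarith

theorem Pplus_le_of_nonpos_of_nonneg (hm : m ≤ 0) (hl : 0 ≤ l) :
    Pplus N lam Lam m l = lam * m + Lam * ((N : ℝ) - 1) * l := by
  rw [Pplus, max_eq_right hm, max_eq_left hl, max_eq_left (by linarith : 0 ≤ -m),
    max_eq_right (by linarith : -l ≤ 0)]
  ring

theorem le_Pminus (hN : 1 ≤ N) (hlam : 0 < lam) (hLam : lam ≤ Lam) :
    lam * max m 0 - Lam * max (-m) 0 - Lam * ((N : ℝ) - 1) * |l| ≤ Pminus N lam Lam m l := by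
  have hn : (0 : ℝ) ≤ (N : ℝ) - 1 := by
    have : (1 : ℝ) ≤ N := by exact_mod_cast hN
    linarith
  have h1 : 0 ≤ lam * (((N : ℝ) - 1) * max l 0) := by positivity
  have h2 : ((N : ℝ) - 1) * max (-l) 0 ≤ ((N : ℝ) - 1) * |l| :=
    mul_le_mul_of_nonneg_left (max_le (neg_le_abs l) (abs_nonneg l)) hn
  have h3 := mul_le_mul_of_nonneg_left h2 (hlam.le.trans hLam)
  rw [Pminus]
  linarith

end Pucci

/-- A function that starts nonnegative and is nondecreasing wherever it is negative stays
nonnegative, in the weighted form `f' ≥ k f`. -/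
theorem nonneg_of_deriv_ge_of_neg {f f' : ℝ → ℝ} {a b k : ℝ} (hf : ContinuousOn f (Icc a b))
    (hd : ∀ r ∈ Ioo a b, HasDerivAt f (f' r) r) (ha : 0 ≤ f a)
    (hneg : ∀ r ∈ Ioo a b, f r < 0 → k * f r ≤ f' r) : ∀ r ∈ Icc a b, 0 ≤ f r := by
  intro r₁ hr₁
  by_contra! hlt
  have hcont : ContinuousOn f (Icc a r₁) := hf.mono (Icc_subset_Icc_right hr₁.2)
  have hK : IsCompact (Icc a r₁ ∩ f ⁻¹' Ici 0) :=
    isCompact_Icc.of_isClosed_subset (hcont.preimage_isClosed_of_isClosed isClosed_Icc isClosed_Ici)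
      inter_subset_left
  obtain ⟨s, ⟨⟨hs, hfs⟩, hmax⟩⟩ := hK.exists_isGreatest ⟨a, ⟨le_rfl, hr₁.1⟩, ha⟩
  have hfs : 0 ≤ f s := hfs
  have hsub : Icc s r₁ ⊆ Icc a b := Icc_subset_Icc hs.1 hr₁.2
  have hmono : MonotoneOn (fun r => f r * Real.exp (-k * r)) (Icc s r₁) := by
    refine monotoneOn_of_hasDerivWithinAt_nonneg (convex_Icc s r₁)
      (f' := fun r => f' r * Real.exp (-k * r) + f r * (Real.exp (-k * r) * -k))
      ((hf.mono hsub).mul (by fun_prop)) ?_ ?_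
    · intro r hr
      rw [interior_Icc] at hr
      have h1 := hd r ⟨hs.1.trans_lt hr.1, hr.2.trans_le hr₁.2⟩
      have h2 : HasDerivAt (fun r => Real.exp (-k * r)) (Real.exp (-k * r) * -k) r := by
        simpa using ((hasDerivAt_id r).const_mul (-k)).exp
      exact (h1.mul h2).hasDerivWithinAt
    · intro r hr
      rw [interior_Icc] at hr
      have hfr : f r < 0 := by
        by_contra! h
        exact absurd (hmax ⟨⟨hs.1.trans hr.1.le, hr.2.le⟩, h⟩) (not_le.2 hr.1)
      have := hneg r ⟨hs.1.trans_lt hr.1, hr.2.trans_le hr₁.2⟩ hfr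
      nlinarith [Real.exp_pos (-k * r)]
  have h := hmono ⟨le_rfl, hs.2⟩ ⟨hs.2, le_rfl⟩ hs.2
  have h1 : 0 ≤ f s * Real.exp (-k * s) := by positivity
  have h2 : f r₁ * Real.exp (-k * r₁) < 0 := mul_neg_of_neg_of_pos hlt (Real.exp_pos _)
  simp only at h
  linarith

/-- Grönwall's inequality for `f' ≤ C f + D` on a compact interval. -/
theorem le_of_deriv_le_linear {f f' : ℝ → ℝ} {a b C D : ℝ} (hC : 0 ≤ C) (hD : 0 ≤ D)
    (hf : ContinuousOn f (Icc a b)) (hd : ∀ r ∈ Ioo a b, HasDerivAt f (f' r) r)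
    (hle : ∀ r ∈ Ioo a b, f' r ≤ C * f r + D) :
    ∀ r ∈ Icc a b, f r ≤ (f a + D * (r - a)) * Real.exp (C * (r - a)) := by
  intro r hr
  have hanti : AntitoneOn (fun r => f r * Real.exp (-C * (r - a)) - D * (r - a)) (Icc a b) := by
    refine antitoneOn_of_hasDerivWithinAt_nonpos (convex_Icc a b)
      (f' := fun r => f' r * Real.exp (-C * (r - a)) + f r * (Real.exp (-C * (r - a)) * -C) - D)
      ((hf.mul (by fun_prop)).sub (by fun_prop)) ?_ ?_
    · intro r hr
      rw [interior_Icc] at hr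
      have h2 : HasDerivAt (fun r => Real.exp (-C * (r - a))) (Real.exp (-C * (r - a)) * -C) r := by
        simpa using (((hasDerivAt_id r).sub_const a).const_mul (-C)).exp
      have h3 : HasDerivAt (fun r => D * (r - a)) D r := by
        simpa using ((hasDerivAt_id r).sub_const a).const_mul D
      exact (((hd r hr).mul h2).sub h3).hasDerivWithinAt
    · intro r hr
      rw [interior_Icc] at hr
      have he : Real.exp (-C * (r - a)) ≤ 1 := by
        rw [Real.exp_le_one_iff]
        nlinarith [hr.1]
      nlinarith [Real.exp_pos (-C * (r - a)), hle r hr,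
        mul_le_mul_of_nonneg_right (hle r hr) (Real.exp_pos (-C * (r - a))).le,
        mul_le_mul_of_nonneg_left he hD]
  have h := hanti ⟨le_rfl, hr.1.trans hr.2⟩ hr hr.1
  simp only [sub_self, mul_zero, Real.exp_zero, mul_one, sub_zero] at h
  have h2 : f r * Real.exp (-C * (r - a)) ≤ f a + D * (r - a) := by linarith
  calc f r = f r * Real.exp (-C * (r - a)) * Real.exp (C * (r - a)) := by
        rw [mul_assoc, ← Real.exp_add]; simp
    _ ≤ _ := mul_le_mul_of_nonneg_right h2 (Real.exp_pos _).le

namespace RadialOperator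

variable {N : ℕ} {lam Lam gam del : ℝ} {F : ℝ → ℝ → ℝ → ℝ → ℝ → ℝ}

theorem map_zero (h : RadialOperator N lam Lam gam del F) (r : ℝ) : F 0 0 0 0 r = 0 := by
  simpa using h.homog 0 le_rfl 0 0 0 0 r

theorem sub_one_nonneg (h : RadialOperator N lam Lam gam del F) : (0 : ℝ) ≤ (N : ℝ) - 1 := by
  have : (1 : ℝ) ≤ N := by exact_mod_cast h.one_le
  linarith

/-- The Wronskian `p v - u q` of a subsolution and a supersolution satisfies a first-order
differential inequality without zeroth-order terms in `u` and `v`. -/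
theorem wronskian_le (h : RadialOperator N lam Lam gam del F) {μ ν u p m v q n r : ℝ}
    (hu : 0 ≤ u) (hv : 0 ≤ v) (hsub : -μ * u ≤ F m (p / r) p u r)
    (hsup : F n (q / r) q v r ≤ -ν * v) :
    (ν - μ) * (u * v) ≤
      Pplus N lam Lam (m * v - u * n) ((p * v - u * q) / r) + gam * |p * v - u * q| := by
  have h1 := h.upper (v * m) (v * (p / r)) (v * p) (v * u) (u * n) (u * (q / r)) (u * q) (u * v) r
  rw [h.homog v hv, h.homog u hu, show v * u - u * v = 0 by ring, abs_zero, mul_zero, add_zero,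
    show v * m - u * n = m * v - u * n by ring, show v * p - u * q = p * v - u * q by ring,
    show v * (p / r) - u * (q / r) = (p * v - u * q) / r by ring] at h1
  nlinarith [mul_le_mul_of_nonneg_left hsub hv, mul_le_mul_of_nonneg_left hsup hu]

variable {R' μ ν : ℝ} {u u' u'' v v' v'' : ℝ → ℝ}

theorem hasDerivAt_wronskian (hu : RadC2 0 R' u u' u'') (hv : RadC2 0 R' v v' v'') {r : ℝ}
    (hr : r ∈ Ioo 0 R') :
    HasDerivAt (fun r => u' r * v r - u r * v' r) (u'' r * v r - u r * v'' r) r := by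
  have hmem : Icc 0 R' ∈ nhds r := Icc_mem_nhds hr.1 hr.2
  have h1 := (hu.1 r ⟨hr.1.le, hr.2.le⟩).hasDerivAt hmem
  have h2 := (hv.1 r ⟨hr.1.le, hr.2.le⟩).hasDerivAt hmem
  refine (((hu.2.2.1 r hr).mul h2).sub (h1.mul (hv.2.2.1 r hr))).congr_deriv ?_
  ring

theorem _root_.RadC2.continuousOn {a : ℝ} (hu : RadC2 a R' u u' u'') : ContinuousOn u (Icc a R') :=
  fun r hr => (hu.1 r hr).continuousWithinAt

theorem continuousOn_wronskian (hu : RadC2 0 R' u u' u'') (hv : RadC2 0 R' v v' v'') :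
    ContinuousOn (fun r => u' r * v r - u r * v' r) (Icc 0 R') :=
  (hu.2.1.mul hv.continuousOn).sub (hu.continuousOn.mul hv.2.1)

theorem wronskian_nonneg (h : RadialOperator N lam Lam gam del F) (hμν : μ ≤ ν)
    (hu : RadC2 0 R' u u' u'') (hv : RadC2 0 R' v v' v'') (hu0 : u' 0 = 0) (hv0 : v' 0 = 0)
    (hup : ∀ r ∈ Ioo 0 R', 0 < u r) (hvp : ∀ r ∈ Ioo 0 R', 0 < v r)
    (hsub : ∀ r ∈ Ioo 0 R', -μ * u r ≤ F (u'' r) (u' r / r) (u' r) (u r) r)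
    (hsup : ∀ r ∈ Ioo 0 R', F (v'' r) (v' r / r) (v' r) (v r) r ≤ -ν * v r) :
    ∀ r ∈ Icc 0 R', 0 ≤ u' r * v r - u r * v' r := by
  refine nonneg_of_deriv_ge_of_neg (k := gam / lam) (continuousOn_wronskian hu hv)
    (fun r hr => hasDerivAt_wronskian hu hv hr) (by simp [hu0, hv0]) ?_
  intro r hr hneg
  have hW := h.wronskian_le (hup r hr).le (hvp r hr).le (hsub r hr) (hsup r hr)
  have hpos : 0 ≤ (ν - μ) * (u r * v r) :=
    mul_nonneg (sub_nonneg.2 hμν) (mul_pos (hup r hr) (hvp r hr)).le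
  set W := u' r * v r - u r * v' r
  set W' := u'' r * v r - u r * v'' r
  have hl := h.lam_pos
  have hg := h.gam_pos
  rcases le_total 0 W' with hW' | hW'
  · exact (mul_nonpos_of_nonneg_of_nonpos (by positivity) hneg.le).trans hW'
  · have := Pplus_le_of_nonpos (Lam := Lam) h.one_le hl hW' (div_neg_of_neg_of_pos hneg hr.1).le
    rw [abs_of_neg hneg] at hW
    rw [div_mul_eq_mul_div, div_le_iff₀ hl]
    linarith

theorem wronskian_pos_right (h : RadialOperator N lam Lam gam del F) (hR' : 0 < R') (hμν : μ < ν)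
    (hu : RadC2 0 R' u u' u'') (hv : RadC2 0 R' v v' v'') (hu0 : u' 0 = 0) (hv0 : v' 0 = 0)
    (hup : ∀ r ∈ Ioo 0 R', 0 < u r) (hvp : ∀ r ∈ Ioo 0 R', 0 < v r)
    (hsub : ∀ r ∈ Ioo 0 R', -μ * u r ≤ F (u'' r) (u' r / r) (u' r) (u r) r)
    (hsup : ∀ r ∈ Ioo 0 R', F (v'' r) (v' r / r) (v' r) (v r) r ≤ -ν * v r) :
    0 < u' R' * v R' - u R' * v' R' := by
  have hnn := h.wronskian_nonneg hμν.le hu hv hu0 hv0 hup hvp hsub hsup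
  have hl := h.lam_pos
  have hg := h.gam_pos
  have hL : 0 ≤ Lam * ((N : ℝ) - 1) := mul_nonneg (hl.le.trans h.lam_le) h.sub_one_nonneg
  obtain ⟨K, hK⟩ : ∃ K, K = (gam + Lam * ((N : ℝ) - 1) * (2 / R')) / lam := ⟨_, rfl⟩
  have hKl : K * lam = gam + Lam * ((N : ℝ) - 1) * (2 / R') := by rw [hK]; field_simp
  have hKpos : 0 < K := by rw [hK]; positivity
  have hsubI : Icc (R' / 2) R' ⊆ Icc 0 R' := Icc_subset_Icc_left (by linarith)
  have hmono : StrictMonoOn (fun r => (u' r * v r - u r * v' r) * Real.exp (K * r))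
      (Icc (R' / 2) R') := by
    refine strictMonoOn_of_hasDerivWithinAt_pos (convex_Icc _ _)
      (f' := fun r => (u'' r * v r - u r * v'' r) * Real.exp (K * r) +
        (u' r * v r - u r * v' r) * (Real.exp (K * r) * K))
      (((continuousOn_wronskian hu hv).mono hsubI).mul (by fun_prop)) ?_ ?_
    · intro r hr
      rw [interior_Icc] at hr
      have h2 : HasDerivAt (fun r => Real.exp (K * r)) (Real.exp (K * r) * K) r := by
        simpa using ((hasDerivAt_id r).const_mul K).exp
      exact ((hasDerivAt_wronskian hu hv ⟨by linarith [hr.1], hr.2⟩).mul h2).hasDerivWithinAt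
    · intro r hr
      rw [interior_Icc] at hr
      have hr0 : r ∈ Ioo 0 R' := ⟨by linarith [hr.1], hr.2⟩
      have hW := h.wronskian_le (hup r hr0).le (hvp r hr0).le (hsub r hr0) (hsup r hr0)
      have hpos : 0 < (ν - μ) * (u r * v r) :=
        mul_pos (sub_pos.2 hμν) (mul_pos (hup r hr0) (hvp r hr0))
      have hWn := hnn r ⟨hr0.1.le, hr0.2.le⟩
      rw [abs_of_nonneg hWn] at hW
      suffices 0 < (u'' r * v r - u r * v'' r) + K * (u' r * v r - u r * v' r) by
        nlinarith [Real.exp_pos (K * r)]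
      set W := u' r * v r - u r * v' r
      set W' := u'' r * v r - u r * v'' r
      have hWr : W / r ≤ W * (2 / R') := by
        rw [div_eq_mul_inv]
        refine mul_le_mul_of_nonneg_left ?_ hWn
        rw [inv_le_comm₀ hr0.1 (by positivity), inv_div]
        exact hr.1.le
      have key : ∀ x ≤ 0, W' ≤ x →
          Pplus N lam Lam W' (W / r) ≤ lam * W' + Lam * ((N : ℝ) - 1) * (W * (2 / R')) := by
        intro x hx hWx
        rw [Pplus_le_of_nonpos_of_nonneg (hWx.trans hx) (div_nonneg hWn hr0.1.le)]
        linarith [mul_le_mul_of_nonneg_left hWr hL]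
      by_cases hW' : W' ≤ 0
      · have := key 0 le_rfl hW'
        have h3 : 0 < lam * (W' + K * W) := by
          have : lam * (W' + K * W) = lam * W' + (K * lam) * W := by ring
          rw [this, hKl]
          linarith
        exact pos_of_mul_pos_right h3 hl.le
      · have := mul_nonneg hKpos.le hWn
        linarith
  have h1 := hmono ⟨le_rfl, by linarith⟩ ⟨by linarith, le_rfl⟩ (by linarith : R' / 2 < R')
  have h2 := hnn (R' / 2) ⟨by linarith, by linarith⟩
  have h3 : 0 < (u' R' * v R' - u R' * v' R') * Real.exp (K * R') :=
    (mul_nonneg h2 (Real.exp_pos _).le).trans_lt h1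
  exact pos_of_mul_pos_left h3 (Real.exp_pos _).le

/-- A subsolution dominates, up to a factor, any supersolution that is positive up to the boundary;
in particular it cannot vanish there. -/
theorem pos_right (h : RadialOperator N lam Lam gam del F) (hR' : 0 < R') (hμν : μ ≤ ν)
    (hu : RadC2 0 R' u u' u'') (hv : RadC2 0 R' v v' v'') (hu0 : u' 0 = 0) (hv0 : v' 0 = 0)
    (hup : ∀ r ∈ Ioo 0 R', 0 < u r) (hvp : ∀ r ∈ Ioc 0 R', 0 < v r)
    (hsub : ∀ r ∈ Ioo 0 R', -μ * u r ≤ F (u'' r) (u' r / r) (u' r) (u r) r)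
    (hsup : ∀ r ∈ Ioo 0 R', F (v'' r) (v' r / r) (v' r) (v r) r ≤ -ν * v r) :
    0 < u R' := by
  have hnn := h.wronskian_nonneg hμν hu hv hu0 hv0 hup (fun r hr => hvp r ⟨hr.1, hr.2.le⟩) hsub hsup
  have hsubI : Icc (R' / 2) R' ⊆ Icc 0 R' := Icc_subset_Icc_left (by linarith)
  have hv_pos : ∀ r ∈ Icc (R' / 2) R', 0 < v r := fun r hr => hvp r ⟨by linarith [hr.1], hr.2⟩
  have hmono : MonotoneOn (fun r => u r / v r) (Icc (R' / 2) R') := by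
    refine monotoneOn_of_hasDerivWithinAt_nonneg (convex_Icc _ _)
      (f' := fun r => (u' r * v r - u r * v' r) / v r ^ 2)
      ((hu.continuousOn.mono hsubI).div (hv.continuousOn.mono hsubI) fun r hr => (hv_pos r hr).ne')
      ?_ ?_
    · intro r hr
      rw [interior_Icc] at hr
      have hmem : Icc 0 R' ∈ nhds r := Icc_mem_nhds (by linarith [hr.1]) hr.2
      have hrI := hsubI ⟨hr.1.le, hr.2.le⟩
      exact (((hu.1 r hrI).hasDerivAt hmem).div ((hv.1 r hrI).hasDerivAt hmem)
        (hv_pos r ⟨hr.1.le, hr.2.le⟩).ne').hasDerivWithinAt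
    · intro r hr
      rw [interior_Icc] at hr
      exact div_nonneg (hnn r (hsubI ⟨hr.1.le, hr.2.le⟩)) (sq_nonneg _)
  have h1 := hmono ⟨le_rfl, by linarith⟩ ⟨by linarith, le_rfl⟩ (by linarith : R' / 2 ≤ R')
  have h2 : 0 < u (R' / 2) / v (R' / 2) :=
    div_pos (hup _ ⟨by linarith, by linarith⟩) (hv_pos _ ⟨le_rfl, by linarith⟩)
  have h3 : 0 < u R' / v R' := h2.trans_le h1
  exact (div_pos_iff_of_pos_right (hv_pos R' ⟨by linarith, le_rfl⟩)).1 h3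

theorem eq_eigenvalue (h : RadialOperator N lam Lam gam del F) (hR' : 0 < R')
    (hu : RadEigenSol F R' μ u u' u'') (hv : RadEigenSol F R' ν v v' v'')
    (hup : ∀ r ∈ Ioo 0 R', 0 < u r) (hvp : ∀ r ∈ Ioo 0 R', 0 < v r) : μ = ν := by
  rcases lt_trichotomy μ ν with hlt | heq | hlt
  · have := h.wronskian_pos_right hR' hlt hu.1 hv.1 hu.2.2.1 hv.2.2.1 hup hvp
      (fun r hr => (hu.2.1 r hr).ge) (fun r hr => (hv.2.1 r hr).le)
    simp [hu.2.2.2, hv.2.2.2] at this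
  · exact heq
  · have := h.wronskian_pos_right hR' hlt hv.1 hu.1 hv.2.2.1 hu.2.2.1 hvp hup
      (fun r hr => (hv.2.1 r hr).ge) (fun r hr => (hu.2.1 r hr).le)
    simp [hu.2.2.2, hv.2.2.2] at this

theorem exists_eq_mul (h : RadialOperator N lam Lam gam del F) (hR' : 0 < R')
    (hu : RadEigenSol F R' μ u u' u'') (hv : RadEigenSol F R' ν v v' v'')
    (hup : ∀ r ∈ Ioo 0 R', 0 < u r) (hvp : ∀ r ∈ Ioo 0 R', 0 < v r) :
    ∃ c : ℝ, 0 < c ∧ ∀ r ∈ Icc (0 : ℝ) R', u r = c * v r := by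
  obtain rfl := h.eq_eigenvalue hR' hu hv hup hvp
  have h1 := h.wronskian_nonneg le_rfl hu.1 hv.1 hu.2.2.1 hv.2.2.1 hup hvp
      (fun r hr => (hu.2.1 r hr).ge) (fun r hr => (hv.2.1 r hr).le)
  have h2 := h.wronskian_nonneg le_rfl hv.1 hu.1 hv.2.2.1 hu.2.2.1 hvp hup
      (fun r hr => (hv.2.1 r hr).ge) (fun r hr => (hu.2.1 r hr).le)
  have hd : ∀ r ∈ Ioo 0 R', HasDerivAt (fun r => u r / v r) 0 r := by
    intro r hr
    have hmem : Icc 0 R' ∈ nhds r := Icc_mem_nhds hr.1 hr.2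
    have hrI : r ∈ Icc 0 R' := ⟨hr.1.le, hr.2.le⟩
    refine (((hu.1.1 r hrI).hasDerivAt hmem).div ((hv.1.1 r hrI).hasDerivAt hmem)
      (hvp r hr).ne').congr_deriv ?_
    rw [show u' r * v r - u r * v' r = 0 by linarith [h1 r hrI, h2 r hrI], zero_div]
  have hmid : R' / 2 ∈ Ioo 0 R' := ⟨by linarith, by linarith⟩
  refine ⟨u (R' / 2) / v (R' / 2), div_pos (hup _ hmid) (hvp _ hmid), ?_⟩
  have hEq : EqOn u (fun r => u (R' / 2) / v (R' / 2) * v r) (Ioo 0 R') := by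
    intro r hr
    have : u r / v r = u (R' / 2) / v (R' / 2) :=
      isOpen_Ioo.is_const_of_deriv_eq_zero isPreconnected_Ioo
        (fun x hx => (hd x hx).differentiableAt.differentiableWithinAt)
        (fun x hx => (hd x hx).deriv) hr hmid
    simp only
    rw [← this, div_mul_cancel₀ _ (hvp r hr).ne']
  have hcl : Icc 0 R' ⊆ closure (Ioo 0 R') := by rw [closure_Ioo hR'.ne]
  exact hEq.of_subset_closure hu.1.continuousOn (continuousOn_const.mul hv.1.continuousOn)
    Ioo_subset_Icc_self hcl

theorem eigenvalue_strictAnti (h : RadialOperator N lam Lam gam del F) {R'' : ℝ} (hR'' : 0 < R'')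
    (hlt : R'' < R') (hu : RadEigenSol F R' μ u u' u'') (hv : RadEigenSol F R'' ν v v' v'')
    (hup : ∀ r ∈ Ioo 0 R', 0 < u r) (hvp : ∀ r ∈ Ioo 0 R'', 0 < v r) : μ < ν := by
  by_contra! hle
  have hsub : Icc 0 R'' ⊆ Icc 0 R' := Icc_subset_Icc_right hlt.le
  have hsub' : Ioo 0 R'' ⊆ Ioo 0 R' := Ioo_subset_Ioo_right hlt.le
  have hu' : RadC2 0 R'' u u' u'' :=
    ⟨fun r hr => (hu.1.1 r (hsub hr)).mono hsub, hu.1.2.1.mono hsub,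
      fun r hr => hu.1.2.2.1 r (hsub' hr), hu.1.2.2.2.mono hsub'⟩
  have := h.pos_right hR'' hle hv.1 hu' hv.2.2.1 hu.2.2.1 hvp
    (fun r hr => hup r ⟨hr.1, hr.2.trans_lt hlt⟩) (fun r hr => (hv.2.1 r hr).ge)
    (fun r hr => (hu.2.1 r (hsub' hr)).le)
  rw [hv.2.2.2] at this
  exact lt_irrefl _ this

end RadialOperator

open Filter Topology

theorem RadC2.mono {a b a' b' : ℝ} {u u' u'' : ℝ → ℝ} (hu : RadC2 a b u u' u'') (ha : a ≤ a')
    (hb : b' ≤ b) : RadC2 a' b' u u' u'' :=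
  ⟨fun r hr => (hu.1 r (Icc_subset_Icc ha hb hr)).mono (Icc_subset_Icc ha hb),
    hu.2.1.mono (Icc_subset_Icc ha hb), fun r hr => hu.2.2.1 r (Ioo_subset_Ioo ha hb hr),
    hu.2.2.2.mono (Ioo_subset_Ioo ha hb)⟩

theorem RadC2.hasDerivAt {a b r : ℝ} {u u' u'' : ℝ → ℝ} (hu : RadC2 a b u u' u'')
    (hr : r ∈ Ioo a b) : HasDerivAt u (u' r) r :=
  (hu.1 r ⟨hr.1.le, hr.2.le⟩).hasDerivAt (Icc_mem_nhds hr.1 hr.2)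

/-- `u` solves the radial eigenvalue equation with parameter `μ` on `(a, b)`. -/
def RadSol (F : ℝ → ℝ → ℝ → ℝ → ℝ → ℝ) (μ a b : ℝ) (u u' u'' : ℝ → ℝ) : Prop :=
  RadC2 a b u u' u'' ∧ ∀ r ∈ Ioo a b, F (u'' r) (u' r / r) (u' r) (u r) r = -μ * u r

theorem RadSol.mono {F : ℝ → ℝ → ℝ → ℝ → ℝ → ℝ} {μ a b a' b' : ℝ} {u u' u'' : ℝ → ℝ}
    (hu : RadSol F μ a b u u' u'') (ha : a ≤ a') (hb : b' ≤ b) : RadSol F μ a' b' u u' u'' :=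
  ⟨hu.1.mono ha hb, fun r hr => hu.2 r (Ioo_subset_Ioo ha hb hr)⟩

namespace RadialOperator

variable {N : ℕ} {lam Lam gam del : ℝ} {F : ℝ → ℝ → ℝ → ℝ → ℝ → ℝ}

/-- The singular coefficient `l` is dissipative: it does not enter this one-sided bound. -/
theorem mul_sub_le (h : RadialOperator N lam Lam gam del F) {m l p u m' l' p' u' r w : ℝ}
    (hw : 0 ≤ w * (l - l')) :
    w * (m - m') ≤
      |w| * ((gam * |p - p'| + del * |u - u'| + |F m l p u r - F m' l' p' u' r|) / lam) := by
  have hl := h.lam_pos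
  have hg := h.gam_pos
  have hd := h.del_pos
  have hlo := h.lower m l p u m' l' p' u' r
  have hup := h.upper m l p u m' l' p' u' r
  have h0 : 0 ≤ (gam * |p - p'| + del * |u - u'| + |F m l p u r - F m' l' p' u' r|) / lam := by
    positivity
  rcases lt_trichotomy w 0 with hw0 | rfl | hw0
  · rw [abs_of_neg hw0]
    rcases le_total 0 (m - m') with hm | hm
    · have := mul_nonneg (neg_pos.2 hw0).le h0
      nlinarith
    · have h1 := Pplus_le_of_nonpos (Lam := Lam) h.one_le hl hm
        (by nlinarith : l - l' ≤ 0)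
      have h2 := neg_abs_le (F m l p u r - F m' l' p' u' r)
      have h3 : -(m - m') ≤
          (gam * |p - p'| + del * |u - u'| + |F m l p u r - F m' l' p' u' r|) / lam := by
        rw [le_div_iff₀ hl]; linarith
      nlinarith
  · simp
  · rw [abs_of_pos hw0]
    rcases le_total 0 (m - m') with hm | hm
    · have h1 := le_Pminus_of_nonneg (Lam := Lam) h.one_le hl hm
        (by nlinarith : 0 ≤ l - l')
      have h2 := le_abs_self (F m l p u r - F m' l' p' u' r)
      have h3 : m - m' ≤
          (gam * |p - p'| + del * |u - u'| + |F m l p u r - F m' l' p' u' r|) / lam := by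
        rw [le_div_iff₀ hl]; linarith
      exact mul_le_mul_of_nonneg_left h3 hw0.le
    · have := mul_nonneg hw0.le h0
      nlinarith

theorem mul_abs_sub_le (h : RadialOperator N lam Lam gam del F) (m l p u m' l' p' u' r : ℝ) :
    lam * |m - m'| ≤ Lam * ((N : ℝ) - 1) * |l - l'| + gam * |p - p'| + del * |u - u'| +
      |F m l p u r - F m' l' p' u' r| := by
  wlog hm : m' ≤ m generalizing m l p u m' l' p' u'
  · have := this m' l' p' u' m l p u (le_of_not_ge hm)
    rwa [abs_sub_comm m', abs_sub_comm l', abs_sub_comm p', abs_sub_comm u',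
      abs_sub_comm (F m' l' p' u' r)] at this
  have h1 := h.lower m l p u m' l' p' u' r
  have h2 := le_Pminus (m := m - m') (l := l - l') h.one_le h.lam_pos h.lam_le
  have h3 := le_abs_self (F m l p u r - F m' l' p' u' r)
  rw [max_eq_left (sub_nonneg.2 hm), max_eq_right (by linarith : -(m - m') ≤ 0)] at h2
  rw [abs_of_nonneg (sub_nonneg.2 hm)]
  linarith

theorem surjective (h : RadialOperator N lam Lam gam del F) (l p u r : ℝ) :
    Function.Surjective fun m => F m l p u r := by
  have hc : Continuous fun m => F m l p u r :=
    h.cont.comp (by fun_prop : Continuous fun m : ℝ => (m, l, p, u, r))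
  have hl := h.lam_pos
  refine hc.surjective ?_ ?_
  · refine tendsto_atTop_mono' _ ?_
      (tendsto_atTop_add_const_right _ (F 0 l p u r) (tendsto_id.const_mul_atTop hl))
    filter_upwards [eventually_ge_atTop 0] with m hm
    have h1 := h.lower m l p u 0 l p u r
    have h2 := le_Pminus_of_nonneg (Lam := Lam) (l := l - l) h.one_le hl
      (by simpa using hm : 0 ≤ m - 0) (by simp)
    simp only [sub_self, abs_zero, mul_zero, sub_zero, id] at h1 h2 ⊢
    linarith
  · refine tendsto_atBot_mono' _ ?_
      (tendsto_atBot_add_const_right _ (F 0 l p u r) (tendsto_id.const_mul_atBot hl))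
    filter_upwards [eventually_le_atBot 0] with m hm
    have h1 := h.upper m l p u 0 l p u r
    have h2 := Pplus_le_of_nonpos (Lam := Lam) (l := l - l) h.one_le hl
      (by simpa using hm : m - 0 ≤ 0) (by simp)
    simp only [sub_self, abs_zero, mul_zero, sub_zero, add_zero, id] at h1 h2 ⊢
    linarith

/-- The equation can be solved for the second derivative, with a continuous right-hand side that is
globally Lipschitz in the lower-order variables. -/
theorem exists_normal_form (h : RadialOperator N lam Lam gam del F) (μ : ℝ) :
    ∃ (G : ℝ → ℝ → ℝ → ℝ → ℝ) (K : ℝ), 0 ≤ K ∧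
      (∀ l p u r, F (G l p u r) l p u r = -μ * u) ∧
      (∀ l p u l' p' u' r, |G l p u r - G l' p' u' r| ≤ K * (|l - l'| + |p - p'| + |u - u'|)) ∧
      (∀ r, G 0 0 0 r = 0) ∧
      Continuous fun z : ℝ × ℝ × ℝ × ℝ => G z.1 z.2.1 z.2.2.1 z.2.2.2 := by
  choose G hG using fun l p u r => h.surjective l p u r (-μ * u)
  simp only at hG
  have hl := h.lam_pos
  have hg := h.gam_pos
  have hd := h.del_pos
  have hL : 0 ≤ Lam * ((N : ℝ) - 1) := mul_nonneg (hl.le.trans h.lam_le) h.sub_one_nonneg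
  refine ⟨G, (Lam * ((N : ℝ) - 1) + gam + del + |μ|) / lam, by positivity, hG, ?_, ?_, ?_⟩
  · intro l p u l' p' u' r
    have h1 := h.mul_abs_sub_le (G l p u r) l p u (G l' p' u' r) l' p' u' r
    rw [hG, hG, show -μ * u - -μ * u' = -(μ * (u - u')) by ring, abs_neg, abs_mul] at h1
    rw [div_mul_eq_mul_div, le_div_iff₀ hl]
    have := abs_nonneg (l - l')
    have := abs_nonneg (p - p')
    have := abs_nonneg (u - u')
    have := abs_nonneg μ
    have e1 : Lam * ((N : ℝ) - 1) * |l - l'| ≤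
        Lam * ((N : ℝ) - 1) * (|l - l'| + |p - p'| + |u - u'|) :=
      mul_le_mul_of_nonneg_left (by linarith) hL
    have e2 : gam * |p - p'| ≤ gam * (|l - l'| + |p - p'| + |u - u'|) :=
      mul_le_mul_of_nonneg_left (by linarith) hg.le
    have e3 : del * |u - u'| ≤ del * (|l - l'| + |p - p'| + |u - u'|) :=
      mul_le_mul_of_nonneg_left (by linarith) hd.le
    have e4 : |μ| * |u - u'| ≤ |μ| * (|l - l'| + |p - p'| + |u - u'|) :=
      mul_le_mul_of_nonneg_left (by linarith) (abs_nonneg μ)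
    linarith
  · intro r
    have h1 := h.mul_abs_sub_le (G 0 0 0 r) 0 0 0 0 0 0 0 r
    rw [hG, h.map_zero] at h1
    simp only [sub_self, abs_zero, mul_zero, add_zero, sub_zero] at h1
    have : |G 0 0 0 r| ≤ 0 := by
      by_contra! h'
      nlinarith
    simpa using this
  · rw [continuous_iff_continuousAt]
    rintro ⟨l, p, u, r⟩
    refine tendsto_iff_norm_sub_tendsto_zero.2 ?_
    have hc : Continuous fun z : ℝ × ℝ × ℝ × ℝ =>
        |-μ * z.2.2.1 - F (G l p u r) z.1 z.2.1 z.2.2.1 z.2.2.2| / lam := by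
      have : Continuous fun z : ℝ × ℝ × ℝ × ℝ => F (G l p u r) z.1 z.2.1 z.2.2.1 z.2.2.2 :=
        h.cont.comp
          (by fun_prop : Continuous fun z : ℝ × ℝ × ℝ × ℝ => (G l p u r, z.1, z.2.1, z.2.2))
      fun_prop
    have hlim := hc.tendsto (l, p, u, r)
    simp only [hG, sub_self, abs_zero, zero_div] at hlim
    refine squeeze_zero (fun _ => norm_nonneg _) (fun z => ?_) hlim
    have h1 := h.mul_abs_sub_le (G z.1 z.2.1 z.2.2.1 z.2.2.2) z.1 z.2.1 z.2.2.1 (G l p u r)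
      z.1 z.2.1 z.2.2.1 z.2.2.2
    rw [hG] at h1
    simp only [sub_self, abs_zero, mul_zero, zero_add] at h1
    rw [Real.norm_eq_abs, le_div_iff₀ hl]
    linarith

/-- A priori bound for solutions starting from `(1, 0)`, stable under truncation of `(u, v)`
to `(q, p)`. -/
theorem exists_apriori_bound (h : RadialOperator N lam Lam gam del F) (μ : ℝ) :
    ∃ C D : ℝ, 0 ≤ C ∧ 0 ≤ D ∧ ∀ {a b : ℝ} {u v p q m : ℝ → ℝ}, 0 ≤ a →
      ContinuousOn u (Icc a b) → ContinuousOn v (Icc a b) →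
      (∀ r ∈ Ioo a b, HasDerivAt u (p r) r) → (∀ r ∈ Ioo a b, HasDerivAt v (m r) r) →
      (∀ r ∈ Ioo a b, |p r| ≤ |v r| ∧ 0 ≤ v r * p r ∧ |q r| ≤ |u r|) →
      (∀ r ∈ Ioo a b, F (m r) (p r / r) (p r) (q r) r = -μ * q r) → u a = 1 → v a = 0 →
      ∀ r ∈ Icc a b, (u r - 1) ^ 2 + v r ^ 2 ≤ D * (r - a) * Real.exp (C * (r - a)) := by
  have hl := h.lam_pos
  have hg := h.gam_pos
  have hd := h.del_pos
  obtain ⟨g, hgdef⟩ : ∃ g, g = gam / lam := ⟨_, rfl⟩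
  obtain ⟨k, hkdef⟩ : ∃ k, k = (del + |μ|) / lam := ⟨_, rfl⟩
  have hg0 : 0 ≤ g := by rw [hgdef]; positivity
  have hk0 : 0 ≤ k := by rw [hkdef]; positivity
  refine ⟨1 + 2 * g + 2 * k, k, by positivity, hk0, ?_⟩
  intro a b u v p q m ha hu hv hud hvd hpq heq hua hva r hr
  have := le_of_deriv_le_linear (f := fun r => (u r - 1) ^ 2 + v r ^ 2)
    (f' := fun r => 2 * (u r - 1) * p r + 2 * v r * m r) (by positivity : 0 ≤ 1 + 2 * g + 2 * k) hk0
    (((hu.sub continuousOn_const).pow 2).add (hv.pow 2)) ?_ ?_ r hr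
  · simpa [hua, hva] using this
  · intro r hr
    refine ((((hud r hr).sub_const 1).pow 2).add ((hvd r hr).pow 2)).congr_deriv ?_
    norm_num
  · intro r hr
    obtain ⟨hp, hvp, hq⟩ := hpq r hr
    have hr0 : 0 < r := ha.trans_lt hr.1
    have h1 := h.mul_sub_le (m := m r) (l := p r / r) (p := p r) (u := q r) (m' := 0) (l' := 0)
      (p' := 0) (u' := 0) (r := r) (w := v r)
      (by rw [sub_zero, ← mul_div_assoc]; exact div_nonneg hvp hr0.le)
    rw [h.map_zero, heq r hr] at h1
    simp only [sub_zero, abs_mul, abs_neg] at h1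
    have h2 : (gam * |p r| + del * |q r| + |μ| * |q r|) / lam = g * |p r| + k * |q r| := by
      rw [hgdef, hkdef]; field_simp; ring
    rw [h2] at h1
    have hq' : |q r| ≤ 1 + |u r - 1| :=
      hq.trans (by
        have := abs_add_le 1 (u r - 1)
        simpa using this)
    have h3 : v r * m r ≤ |v r| * (g * |v r| + k * (1 + |u r - 1|)) :=
      h1.trans (mul_le_mul_of_nonneg_left (add_le_add (mul_le_mul_of_nonneg_left hp hg0)
        (mul_le_mul_of_nonneg_left hq' hk0)) (abs_nonneg _))
    have h4 : (u r - 1) * p r ≤ |u r - 1| * |v r| := by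
      refine (le_abs_self _).trans ?_
      rw [abs_mul]
      exact mul_le_mul_of_nonneg_left hp (abs_nonneg _)
    rw [← sq_abs (u r - 1), ← sq_abs (v r)]
    have e1 := mul_nonneg hk0 (sq_nonneg (|v r| - 1))
    have e2 := mul_nonneg hk0 (sq_nonneg (|v r| - |u r - 1|))
    have e3 := mul_nonneg hg0 (sq_nonneg (|u r - 1|))
    nlinarith [sq_nonneg (|v r| - |u r - 1|), mul_nonneg hk0 (sq_nonneg (|u r - 1|))]

/-- Continuous dependence of solutions on the initial data and on the parameter. -/
theorem exists_stability_bound (h : RadialOperator N lam Lam gam del F) {κ : ℝ} (hκ : 0 ≤ κ) :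
    ∃ C : ℝ, 0 ≤ C ∧ ∀ {μ ν M a b : ℝ} {u u' u'' v v' v'' : ℝ → ℝ}, |μ| ≤ κ → 0 ≤ a →
      RadSol F μ a b u u' u'' → RadSol F ν a b v v' v'' → (∀ r ∈ Ioo a b, |v r| ≤ M) →
      ∀ r ∈ Icc a b, (u r - v r) ^ 2 + (u' r - v' r) ^ 2 ≤
        ((u a - v a) ^ 2 + (u' a - v' a) ^ 2 + C * ((μ - ν) * M) ^ 2 * (r - a)) *
          Real.exp (C * (r - a)) := by
  have hl := h.lam_pos
  have hg := h.gam_pos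
  have hd := h.del_pos
  obtain ⟨g, hgdef⟩ : ∃ g, g = gam / lam := ⟨_, rfl⟩
  obtain ⟨k, hkdef⟩ : ∃ k, k = (del + κ) / lam := ⟨_, rfl⟩
  obtain ⟨c, hcdef⟩ : ∃ c, c = 1 / lam := ⟨_, rfl⟩
  have hg0 : 0 ≤ g := by rw [hgdef]; positivity
  have hk0 : 0 ≤ k := by rw [hkdef]; positivity
  have hc0 : 0 ≤ c := by rw [hcdef]; positivity
  refine ⟨1 + 2 * g + k + c, by positivity, ?_⟩
  intro μ ν M a b u u' u'' v v' v'' hμ ha hu hv hM r hr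
  have hC : 0 ≤ 1 + 2 * g + k + c := by positivity
  refine le_of_deriv_le_linear (f := fun r => (u r - v r) ^ 2 + (u' r - v' r) ^ 2)
    (f' := fun r => 2 * (u r - v r) * (u' r - v' r) + 2 * (u' r - v' r) * (u'' r - v'' r)) hC
    (mul_nonneg hC (sq_nonneg _))
    (((hu.1.continuousOn.sub hv.1.continuousOn).pow 2).add ((hu.1.2.1.sub hv.1.2.1).pow 2))
    ?_ ?_ r hr
  · intro r hr
    refine ((((hu.1.hasDerivAt hr).sub (hv.1.hasDerivAt hr)).pow 2).add
      (((hu.1.2.2.1 r hr).sub (hv.1.2.2.1 r hr)).pow 2)).congr_deriv ?_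
    norm_num
  · intro r hr
    have hr0 : 0 < r := ha.trans_lt hr.1
    have h1 := h.mul_sub_le (m := u'' r) (l := u' r / r) (p := u' r) (u := u r) (m' := v'' r)
      (l' := v' r / r) (p' := v' r) (u' := v r) (r := r) (w := u' r - v' r)
      (by rw [← sub_div, ← mul_div_assoc]; exact div_nonneg (mul_self_nonneg _) hr0.le)
    rw [hu.2 r hr, hv.2 r hr] at h1
    have h2 : |-μ * u r - -ν * v r| ≤ κ * |u r - v r| + |(μ - ν) * M| := by
      calc |-μ * u r - -ν * v r| = |μ * (u r - v r) + (μ - ν) * v r| := by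
            rw [← abs_neg]; congr 1; ring
        _ ≤ |μ * (u r - v r)| + |(μ - ν) * v r| := abs_add_le _ _
        _ ≤ _ := by
          rw [abs_mul, abs_mul, abs_mul]
          have := (hM r hr).trans (le_abs_self M)
          gcongr
    have h3 : (gam * |u' r - v' r| + del * |u r - v r| + |-μ * u r - -ν * v r|) / lam ≤
        g * |u' r - v' r| + k * |u r - v r| + c * |(μ - ν) * M| := by
      have : g * |u' r - v' r| + k * |u r - v r| + c * |(μ - ν) * M| =
          (gam * |u' r - v' r| + del * |u r - v r| + (κ * |u r - v r| + |(μ - ν) * M|)) / lam := by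
        rw [hgdef, hkdef, hcdef]; field_simp; ring
      rw [this]
      gcongr
    have h4 := h1.trans (mul_le_mul_of_nonneg_left h3 (abs_nonneg _))
    have h5 : (u r - v r) * (u' r - v' r) ≤ |u r - v r| * |u' r - v' r| := by
      rw [← abs_mul]; exact le_abs_self _
    rw [← sq_abs (u r - v r), ← sq_abs (u' r - v' r), ← sq_abs ((μ - ν) * M)]
    generalize |u r - v r| = z at *
    generalize |u' r - v' r| = w at *
    generalize |(μ - ν) * M| = e at *
    nlinarith [sq_nonneg (w - z), mul_nonneg hk0 (sq_nonneg (w - z)),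
      mul_nonneg hc0 (sq_nonneg (w - e)), mul_nonneg hg0 (sq_nonneg z),
      mul_nonneg hc0 (sq_nonneg z), mul_nonneg hg0 (sq_nonneg e), mul_nonneg hk0 (sq_nonneg e),
      sq_nonneg e]

end RadialOperator

/-- Truncation of a real number to `[-B, B]`. -/
def truncate (B x : ℝ) : ℝ := max (-B) (min x B)

theorem abs_truncate_sub_le (B x y : ℝ) : |truncate B x - truncate B y| ≤ |x - y| := by
  refine (abs_max_sub_max_le_max _ _ _ _).trans ?_
  rw [sub_self, abs_zero, max_eq_right (abs_nonneg _)]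
  refine (abs_min_sub_min_le_max _ _ _ _).trans ?_
  rw [sub_self, abs_zero, max_eq_left (abs_nonneg _)]

theorem truncate_of_abs_le {B x : ℝ} (h : |x| ≤ B) : truncate B x = x := by
  rw [truncate, min_eq_left (abs_le.1 h).2, max_eq_right (abs_le.1 h).1]

theorem abs_truncate_le {B : ℝ} (hB : 0 ≤ B) (x : ℝ) : |truncate B x| ≤ B := by
  rw [abs_le, truncate]
  exact ⟨le_max_left _ _, max_le (by linarith) (min_le_right _ _)⟩

theorem abs_truncate_le_abs {B : ℝ} (hB : 0 ≤ B) (x : ℝ) : |truncate B x| ≤ |x| := by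
  have := abs_truncate_sub_le B x 0
  rwa [truncate_of_abs_le (by simpa using hB : |(0 : ℝ)| ≤ B), sub_zero, sub_zero] at this

theorem mul_truncate_nonneg {B : ℝ} (hB : 0 ≤ B) (x : ℝ) : 0 ≤ x * truncate B x := by
  rcases le_total 0 x with hx | hx
  · exact mul_nonneg hx ((le_min hx hB).trans (le_max_right _ _))
  · refine mul_nonneg_of_nonpos_of_nonpos hx (max_le (by linarith) ?_)
    exact (min_le_left _ _).trans hx

namespace RadialOperator

variable {N : ℕ} {lam Lam gam del : ℝ} {F : ℝ → ℝ → ℝ → ℝ → ℝ → ℝ}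

/-- The initial value problem away from the origin. -/
theorem exists_radSol_of_pos (h : RadialOperator N lam Lam gam del F) (μ : ℝ) {a b : ℝ}
    (ha : 0 < a) (hab : a < b) :
    ∃ u u' u'' : ℝ → ℝ, RadSol F μ a b u u' u'' ∧ u a = 1 ∧ u' a = 0 := by
  obtain ⟨G, K, hK, hG, hLip, hG0, hGc⟩ := h.exists_normal_form μ
  obtain ⟨C, D, hC, hD, hbound⟩ := h.exists_apriori_bound μ
  obtain ⟨E, hE⟩ : ∃ E, E = D * (b - a) * Real.exp (C * (b - a)) := ⟨_, rfl⟩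
  have hba : 0 < b - a := sub_pos.2 hab
  have hE0 : 0 ≤ E := by rw [hE]; positivity
  obtain ⟨B, hB⟩ : ∃ B, B = 2 + E := ⟨_, rfl⟩
  have hB0 : 0 ≤ B := by rw [hB]; positivity
  let f : ℝ → ℝ × ℝ → ℝ × ℝ := fun t x =>
    (truncate B x.2, G (truncate B x.2 / t) (truncate B x.2) (truncate B x.1) t)
  have hdiv : ∀ t ∈ Icc a b, ∀ x y : ℝ, |x / t - y / t| ≤ |x - y| / a := by
    intro t ht x y
    rw [← sub_div, abs_div, abs_of_pos (ha.trans_le ht.1)]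
    exact div_le_div_of_nonneg_left (abs_nonneg _) ha ht.1
  have hGd : ∀ t ∈ Icc a b, ∀ p q u v c : ℝ, |p - q| ≤ c → |u - v| ≤ c →
      |G (p / t) p u t - G (q / t) q v t| ≤ K * (1 / a + 2) * c := by
    intro t ht p q u v c h1 h2
    refine (hLip _ _ _ _ _ _ t).trans ?_
    rw [mul_assoc]
    refine mul_le_mul_of_nonneg_left ?_ hK
    have h3 : |p / t - q / t| ≤ c / a :=
      (hdiv t ht p q).trans (div_le_div_of_nonneg_right h1 ha.le)
    have : (1 / a + 2) * c = c / a + c + c := by ring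
    linarith
  obtain ⟨L, hL⟩ : ∃ L, L = 1 + K * (1 / a + 2) := ⟨_, rfl⟩
  have hL0 : 0 ≤ L := by rw [hL]; positivity
  have hL1 : 1 ≤ L := by
    rw [hL]
    have : 0 ≤ K * (1 / a + 2) := by positivity
    linarith
  have hL2 : K * (1 / a + 2) ≤ L := by rw [hL]; linarith
  have hfl : ∀ t ∈ Icc a b, ∀ x y, dist (f t x) (f t y) ≤ L * dist x y := by
    intro t ht x y
    have h1 : |x.1 - y.1| ≤ dist x y := le_max_left _ _
    have h2 : |x.2 - y.2| ≤ dist x y := le_max_right _ _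
    have h1' := (abs_truncate_sub_le B _ _).trans h1
    have h2' := (abs_truncate_sub_le B _ _).trans h2
    rw [Prod.dist_eq]
    refine max_le ?_ ?_
    · refine h2'.trans ?_
      nlinarith [dist_nonneg (x := x) (y := y)]
    · refine (hGd t ht _ _ _ _ _ h2' h1').trans ?_
      exact mul_le_mul_of_nonneg_right hL2 dist_nonneg
  have hfb : ∀ t ∈ Icc a b, ∀ x, ‖f t x‖ ≤ L * B := by
    intro t ht x
    have h1 := abs_truncate_le hB0 x.1
    have h2 := abs_truncate_le hB0 x.2
    rw [Prod.norm_def]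
    refine max_le ?_ ?_
    · refine (Real.norm_eq_abs _).le.trans (h2.trans ?_)
      nlinarith
    · have h3 := hGd t ht (truncate B x.2) 0 (truncate B x.1) 0 B (by simpa using h2)
        (by simpa using h1)
      rw [zero_div, hG0, sub_zero] at h3
      exact h3.trans (mul_le_mul_of_nonneg_right hL2 hB0)
  have hfc : ∀ x, ContinuousOn (fun t => f t x) (Icc a b) := by
    intro x
    refine continuousOn_const.prodMk ?_
    refine hGc.comp_continuousOn (f := fun t : ℝ =>
      (truncate B x.2 / t, truncate B x.2, truncate B x.1, t)) ?_
    refine ContinuousOn.prodMk ?_ (by fun_prop)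
    exact continuousOn_const.div continuousOn_id fun t ht => (ha.trans_le ht.1).ne'
  have hpl : IsPicardLindelof f (tmin := a) (tmax := b) ⟨a, le_rfl, hab.le⟩ ((1, 0) : ℝ × ℝ)
      (L * B * (b - a)).toNNReal 0 (L * B).toNNReal L.toNNReal := by
    refine ⟨fun t ht => ?_, fun x _ => hfc x, fun t ht x _ => ?_, ?_⟩
    · refine (LipschitzWith.of_dist_le_mul fun x y => ?_).lipschitzOnWith
      rw [Real.coe_toNNReal _ hL0]
      exact hfl t ht x y
    · rw [Real.coe_toNNReal _ (by positivity)]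
      exact hfb t ht x
    · rw [Real.coe_toNNReal _ (by positivity), Real.coe_toNNReal _ (by positivity)]
      simp [hba.le]
  obtain ⟨α, hα0, hα⟩ := hpl.exists_eq_forall_mem_Icc_hasDerivWithinAt₀
  simp only at hα0
  have hu : ∀ t ∈ Icc a b, HasDerivWithinAt (fun t => (α t).1) (truncate B (α t).2) (Icc a b) t :=
    fun t ht => (hα t ht).fst
  have hv : ∀ t ∈ Icc a b, HasDerivWithinAt (fun t => (α t).2)
      (G (truncate B (α t).2 / t) (truncate B (α t).2) (truncate B (α t).1) t) (Icc a b) t :=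
    fun t ht => (hα t ht).snd
  have huc : ContinuousOn (fun t => (α t).1) (Icc a b) := fun t ht => (hu t ht).continuousWithinAt
  have hvc : ContinuousOn (fun t => (α t).2) (Icc a b) := fun t ht => (hv t ht).continuousWithinAt
  have hest := hbound (q := fun t => truncate B (α t).1) ha.le huc hvc
    (fun r hr => (hu r ⟨hr.1.le, hr.2.le⟩).hasDerivAt (Icc_mem_nhds hr.1 hr.2))
    (fun r hr => (hv r ⟨hr.1.le, hr.2.le⟩).hasDerivAt (Icc_mem_nhds hr.1 hr.2))
    (fun r _ => ⟨abs_truncate_le_abs hB0 _, mul_truncate_nonneg hB0 _, abs_truncate_le_abs hB0 _⟩)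
    (fun r _ => hG _ _ _ _) (by simp [hα0]) (by simp [hα0])
  have hle : ∀ r ∈ Icc a b, ((α r).1 - 1) ^ 2 + (α r).2 ^ 2 ≤ E := by
    intro r hr
    refine (hest r hr).trans ?_
    rw [hE]
    have h1 : r - a ≤ b - a := by linarith [hr.2]
    have h2 : 0 ≤ r - a := by linarith [hr.1]
    gcongr
  have htu : ∀ r ∈ Icc a b, truncate B (α r).1 = (α r).1 := by
    intro r hr
    refine truncate_of_abs_le (abs_le_of_sq_le_sq ?_ hB0)
    nlinarith [hle r hr, sq_nonneg ((α r).1 - 2), sq_nonneg (α r).2]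
  have htv : ∀ r ∈ Icc a b, truncate B (α r).2 = (α r).2 := by
    intro r hr
    refine truncate_of_abs_le (abs_le_of_sq_le_sq ?_ hB0)
    nlinarith [hle r hr, sq_nonneg ((α r).1 - 1)]
  refine ⟨fun t => (α t).1, fun t => (α t).2, fun t => G ((α t).2 / t) (α t).2 (α t).1 t,
    ⟨⟨?_, hvc, ?_, ?_⟩, fun r _ => hG _ _ _ _⟩, by simp [hα0], by simp [hα0]⟩
  · intro r hr
    have := hu r hr
    rwa [htv r hr] at this
  · intro r hr
    have hr' : r ∈ Icc a b := ⟨hr.1.le, hr.2.le⟩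
    have := (hv r hr').hasDerivAt (Icc_mem_nhds hr.1 hr.2)
    rwa [htv r hr', htu r hr'] at this
  · refine ContinuousOn.mono ?_ Ioo_subset_Icc_self
    refine hGc.comp_continuousOn (f := fun t => ((α t).2 / t, (α t).2, (α t).1, t)) ?_
    exact (hvc.div continuousOn_id fun t ht => (ha.trans_le ht.1).ne').prodMk
      (hvc.prodMk (huc.prodMk continuousOn_id))

end RadialOperator

namespace RadialOperator

variable {N : ℕ} {lam Lam gam del : ℝ} {F : ℝ → ℝ → ℝ → ℝ → ℝ → ℝ}

/-- The family of solutions started at radius `a` is uniformly Cauchy as `a → 0`. -/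
theorem exists_uniform_bounds (h : RadialOperator N lam Lam gam del F) (μ T : ℝ) :
    ∃ Q : ℝ, 0 ≤ Q ∧ ∀ {a : ℝ} {u u' u'' : ℝ → ℝ}, 0 < a → a < T →
      RadSol F μ a T u u' u'' → u a = 1 → u' a = 0 →
      (∀ r ∈ Icc a T, (u r - 1) ^ 2 + u' r ^ 2 ≤ Q * r) ∧
      ∀ {c : ℝ} {v v' v'' : ℝ → ℝ}, 0 < c → c ≤ a → RadSol F μ c T v v' v'' → v c = 1 → v' c = 0 →
        ∀ r ∈ Icc a T, |u r - v r| ≤ √(Q * a) ∧ |u' r - v' r| ≤ √(Q * a) := by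
  obtain ⟨C, D, hC, hD, hbound⟩ := h.exists_apriori_bound μ
  obtain ⟨S, hS, hstab⟩ := h.exists_stability_bound (abs_nonneg μ)
  have hE1 : 1 ≤ Real.exp (C * |T|) := Real.one_le_exp (by positivity)
  have hE2 : 1 ≤ Real.exp (S * |T|) := Real.one_le_exp (by positivity)
  have hap : ∀ {a : ℝ} {u u' u'' : ℝ → ℝ}, 0 < a → RadSol F μ a T u u' u'' → u a = 1 →
      u' a = 0 → ∀ r ∈ Icc a T, (u r - 1) ^ 2 + u' r ^ 2 ≤ D * r * Real.exp (C * |T|) := by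
    intro a u u' u'' ha hu hua hua' r hr
    refine (hbound ha.le hu.1.continuousOn hu.1.2.1 (fun r hr => hu.1.hasDerivAt hr)
      (fun r hr => hu.1.2.2.1 r hr) (fun r _ => ⟨le_rfl, mul_self_nonneg _, le_rfl⟩)
      (fun r hr => hu.2 r hr) hua hua' r hr).trans ?_
    have h1 : r - a ≤ |T| := (by linarith [hr.2] : r - a ≤ T).trans (le_abs_self T)
    have h2 : r - a ≤ r := by linarith
    have h3 : 0 ≤ r := ha.le.trans hr.1
    gcongr
  refine ⟨D * Real.exp (C * |T|) * Real.exp (S * |T|), by positivity, ?_⟩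
  intro a u u' u'' ha haT hu hua hua'
  refine ⟨fun r hr => ?_, ?_⟩
  · refine (hap ha hu hua hua' r hr).trans ?_
    have h3 : 0 ≤ r := ha.le.trans hr.1
    have : 0 ≤ D * r * Real.exp (C * |T|) := by positivity
    nlinarith
  · intro c v v' v'' hc hca hv hvc hvc' r hr
    have hva := hap hc hv hvc hvc' a ⟨hca, haT.le⟩
    obtain ⟨M, hM⟩ := isCompact_Icc.exists_bound_of_continuousOn
      (hv.mono hca le_rfl).1.continuousOn
    have h1 := hstab (M := M) le_rfl ha.le hu (hv.mono hca le_rfl)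
      (fun r hr => hM r ⟨hr.1.le, hr.2.le⟩) r hr
    have h2 : (u r - v r) ^ 2 + (u' r - v' r) ^ 2 ≤
        D * Real.exp (C * |T|) * Real.exp (S * |T|) * a := by
      refine h1.trans ?_
      have h3 : r - a ≤ |T| := (by linarith [hr.2] : r - a ≤ T).trans (le_abs_self T)
      have h4 : (u a - v a) ^ 2 + (u' a - v' a) ^ 2 + S * ((μ - μ) * M) ^ 2 * (r - a) ≤
          D * a * Real.exp (C * |T|) := by
        rw [hua, hua', sub_self, zero_mul]
        linarith
      calc _ ≤ D * a * Real.exp (C * |T|) * Real.exp (S * |T|) := by gcongr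
        _ = _ := by ring
    exact ⟨Real.abs_le_sqrt (by linarith [sq_nonneg (u' r - v' r)]),
      Real.abs_le_sqrt (by linarith [sq_nonneg (u r - v r)])⟩

/-- The initial value problem at the origin. -/
theorem exists_radSol (h : RadialOperator N lam Lam gam del F) (μ : ℝ) {b : ℝ} (hb : 0 < b) :
    ∃ u u' u'' : ℝ → ℝ, RadSol F μ 0 b u u' u'' ∧ u 0 = 1 ∧ u' 0 = 0 := by
  obtain ⟨T, hbT⟩ := exists_gt b
  have hT : 0 < T := hb.trans hbT
  obtain ⟨G, K, hK, hG, hLip, -, hGc⟩ := h.exists_normal_form μ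
  obtain ⟨Q, hQ, hunif⟩ := h.exists_uniform_bounds μ T
  obtain ⟨a, ha_anti, ha, ha_lim⟩ := exists_seq_strictAnti_tendsto' hT
  choose u u' u'' hsol hu0 hu0' using fun n => h.exists_radSol_of_pos μ (ha n).1 (ha n).2
  have hcauchy : ∀ {n m : ℕ}, n ≤ m → ∀ r ∈ Icc (a n) T,
      |u n r - u m r| ≤ √(Q * a n) ∧ |u' n r - u' m r| ≤ √(Q * a n) := fun {n m} hnm =>
    (hunif (ha n).1 (ha n).2 (hsol n) (hu0 n) (hu0' n)).2 (ha m).1 (ha_anti.antitone hnm) (hsol m)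
      (hu0 m) (hu0' m)
  have hb_lim : Tendsto (fun n => √(Q * a n)) atTop (𝓝 0) := by
    have := (ha_lim.const_mul Q).sqrt
    simpa using this
  have hlimit : ∀ w : ℕ → ℝ → ℝ,
      (∀ {n m : ℕ}, n ≤ m → ∀ r ∈ Icc (a n) T, |w n r - w m r| ≤ √(Q * a n)) →
      ∀ r ∈ Ioc 0 T, ∃ x, Tendsto (fun n => w n r) atTop (𝓝 x) := by
    intro w hw r hr
    refine cauchySeq_tendsto_of_complete (Metric.cauchySeq_iff'.2 fun ε hε => ?_)
    obtain ⟨n, hn1, hn2⟩ := ((ha_lim.eventually_lt_const hr.1).and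
      (hb_lim.eventually_lt_const hε)).exists
    refine ⟨n, fun m hm => ?_⟩
    rw [dist_comm, Real.dist_eq]
    exact (hw hm r ⟨hn1.le, hr.2⟩).trans_lt hn2
  have hext : ∀ w : ℕ → ℝ → ℝ, ∀ y : ℝ,
      (∀ {n m : ℕ}, n ≤ m → ∀ r ∈ Icc (a n) T, |w n r - w m r| ≤ √(Q * a n)) →
      ∃ x : ℝ → ℝ, x 0 = y ∧ (∀ r ∈ Ioc 0 T, Tendsto (fun n => w n r) atTop (𝓝 (x r))) ∧
        ∀ n, ∀ r ∈ Icc (a n) T, |w n r - x r| ≤ √(Q * a n) := by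
    intro w y hw
    choose! x hx using hlimit w hw
    have hx' : ∀ r ∈ Ioc 0 T, Tendsto (fun n => w n r) atTop (𝓝 (if r = 0 then y else x r)) := by
      intro r hr
      rw [if_neg hr.1.ne']
      exact hx r hr
    refine ⟨fun r => if r = 0 then y else x r, if_pos rfl, hx', fun n r hr => ?_⟩
    refine le_of_tendsto (tendsto_const_nhds.sub (hx' r ⟨(ha n).1.trans_le hr.1, hr.2⟩)).abs ?_
    filter_upwards [eventually_ge_atTop n] with m hm using hw hm r hr
  obtain ⟨U, hU0, hUlim, hUb⟩ := hext u 1 fun hnm r hr => (hcauchy hnm r hr).1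
  obtain ⟨V, hV0, hVlim, hVb⟩ := hext u' 0 fun hnm r hr => (hcauchy hnm r hr).2
  have hnear : ∀ r ∈ Ioc 0 T, (U r - 1) ^ 2 + V r ^ 2 ≤ Q * r := by
    intro r hr
    refine le_of_tendsto ((((hUlim r hr).sub_const 1).pow 2).add ((hVlim r hr).pow 2)) ?_
    filter_upwards [ha_lim.eventually_lt_const hr.1] with n hn
    exact (hunif (ha n).1 (ha n).2 (hsol n) (hu0 n) (hu0' n)).1 r ⟨hn.le, hr.2⟩
  have hUd : ∀ r ∈ Ioo 0 T, HasDerivAt U (V r) r := by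
    intro r hr
    refine hasDerivAt_of_tendstoUniformlyOn (l := atTop) (f := u) (f' := u')
      (isOpen_Ioo (a := r / 2) (b := T)) ?_ ?_ ?_ ⟨by linarith [hr.1], hr.2⟩
    · refine Metric.tendstoUniformlyOn_iff.2 fun ε hε => ?_
      filter_upwards [ha_lim.eventually_lt_const (half_pos hr.1), hb_lim.eventually_lt_const hε]
        with n hn1 hn2 x hx
      rw [dist_comm, Real.dist_eq]
      exact (hVb n x ⟨(hn1.trans hx.1).le, hx.2.le⟩).trans_lt hn2
    · filter_upwards [ha_lim.eventually_lt_const (half_pos hr.1)] with n hn x hx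
      exact (hsol n).1.hasDerivAt ⟨hn.trans hx.1, hx.2⟩
    · exact fun x hx => hUlim x ⟨(half_pos hr.1).trans hx.1, hx.2.le⟩
  have heq : ∀ n, ∀ r ∈ Ioo (a n) T, u'' n r = G (u' n r / r) (u' n r) (u n r) r := by
    intro n r hr
    have h1 := h.mul_abs_sub_le (u'' n r) (u' n r / r) (u' n r) (u n r)
      (G (u' n r / r) (u' n r) (u n r) r) (u' n r / r) (u' n r) (u n r) r
    rw [hG, (hsol n).2 r hr] at h1
    simp only [sub_self, abs_zero, mul_zero, add_zero] at h1
    have h2 : |u'' n r - G (u' n r / r) (u' n r) (u n r) r| ≤ 0 := by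
      by_contra! h'
      nlinarith [h.lam_pos]
    linarith [abs_nonpos_iff.1 h2]
  have hVd : ∀ r ∈ Ioo 0 T, HasDerivAt V (G (V r / r) (V r) (U r) r) r := by
    intro r hr
    have hr2 := half_pos hr.1
    refine hasDerivAt_of_tendstoUniformlyOn (l := atTop) (f := u') (f' := u'')
      (g' := fun r => G (V r / r) (V r) (U r) r)
      (isOpen_Ioo (a := r / 2) (b := T)) ?_ ?_ ?_ ⟨by linarith [hr.1], hr.2⟩
    · have hc : Tendsto (fun n => K * (1 / (r / 2) + 2) * √(Q * a n)) atTop (𝓝 0) := by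
        simpa using hb_lim.const_mul (K * (1 / (r / 2) + 2))
      refine Metric.tendstoUniformlyOn_iff.2 fun ε hε => ?_
      filter_upwards [ha_lim.eventually_lt_const hr2, hc.eventually_lt_const hε]
        with n hn1 hn2 x hx
      have hx' : x ∈ Icc (a n) T := ⟨(hn1.trans hx.1).le, hx.2.le⟩
      rw [dist_comm, Real.dist_eq, heq n x ⟨hn1.trans hx.1, hx.2⟩]
      refine ((hLip _ _ _ _ _ _ x).trans ?_).trans_lt hn2
      rw [mul_assoc]
      refine mul_le_mul_of_nonneg_left ?_ hK
      have h1 := hUb n x hx'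
      have h2 := hVb n x hx'
      have h3 : |u' n x / x - V x / x| ≤ √(Q * a n) / (r / 2) := by
        rw [← sub_div, abs_div, abs_of_pos (hr2.trans hx.1)]
        exact div_le_div₀ (Real.sqrt_nonneg _) h2 hr2 hx.1.le
      have : (1 / (r / 2) + 2) * √(Q * a n) =
          √(Q * a n) / (r / 2) + √(Q * a n) + √(Q * a n) := by ring
      linarith
    · filter_upwards [ha_lim.eventually_lt_const hr2] with n hn x hx
      exact (hsol n).1.2.2.1 x ⟨hn.trans hx.1, hx.2⟩
    · exact fun x hx => hVlim x ⟨hr2.trans hx.1, hx.2.le⟩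
  have hsq : Tendsto (fun r => √(Q * r)) (𝓝[>] 0) (𝓝 0) := by
    have : Continuous fun r => √(Q * r) := by fun_prop
    simpa using (this.tendsto 0).mono_left nhdsWithin_le_nhds
  have hmem : Ioo 0 T ∈ 𝓝[>] (0 : ℝ) := Ioo_mem_nhdsGT hT
  have hUt : Tendsto U (𝓝[>] 0) (𝓝 1) := by
    refine tendsto_iff_norm_sub_tendsto_zero.2
      (squeeze_zero' (Eventually.of_forall fun _ => norm_nonneg _) ?_ hsq)
    filter_upwards [hmem] with r hr
    exact Real.abs_le_sqrt (by linarith [hnear r ⟨hr.1, hr.2.le⟩, sq_nonneg (V r)])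
  have hVt : Tendsto V (𝓝[>] 0) (𝓝 0) := by
    refine squeeze_zero_norm' ?_ hsq
    filter_upwards [hmem] with r hr
    exact Real.abs_le_sqrt (by linarith [hnear r ⟨hr.1, hr.2.le⟩, sq_nonneg (U r - 1)])
  have hUd0 : HasDerivWithinAt U (V 0) (Ici 0) 0 := by
    refine hasDerivWithinAt_Ici_of_tendsto_deriv (s := Ioo 0 T)
      (fun r hr => (hUd r hr).differentiableAt.differentiableWithinAt) ?_ hmem ?_
    · rw [ContinuousWithinAt, hU0]
      exact hUt.mono_left (nhdsWithin_mono _ Ioo_subset_Ioi_self)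
    · rw [hV0]
      refine hVt.congr' ?_
      filter_upwards [hmem] with r hr using (hUd r hr).deriv.symm
  have hVc : ContinuousOn V (Icc 0 b) := by
    intro r hr
    rcases hr.1.eq_or_lt with rfl | hr0
    · have : ContinuousWithinAt V (Ici 0) 0 := by
        rw [← continuousWithinAt_Ioi_iff_Ici, ContinuousWithinAt, hV0]
        exact hVt
      exact this.mono Icc_subset_Ici_self
    · exact (hVd r ⟨hr0, hr.2.trans_lt hbT⟩).continuousAt.continuousWithinAt
  refine ⟨U, V, fun r => G (V r / r) (V r) (U r) r, ⟨⟨?_, hVc, ?_, ?_⟩, fun r _ => hG _ _ _ _⟩,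
    hU0, hV0⟩
  · intro r hr
    rcases hr.1.eq_or_lt with rfl | hr0
    · exact hUd0.mono Icc_subset_Ici_self
    · exact (hUd r ⟨hr0, hr.2.trans_lt hbT⟩).hasDerivWithinAt
  · exact fun r hr => hVd r ⟨hr.1, hr.2.trans hbT⟩
  · have hUc : ContinuousOn U (Ioo 0 b) := fun r hr =>
      (hUd r ⟨hr.1, hr.2.trans hbT⟩).continuousAt.continuousWithinAt
    have hVc' := hVc.mono Ioo_subset_Icc_self
    refine hGc.comp_continuousOn (f := fun t => (V t / t, V t, U t, t)) ?_
    exact (hVc'.div continuousOn_id fun t ht => ht.1.ne').prodMk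
      (hVc'.prodMk (hUc.prodMk continuousOn_id))

end RadialOperator

namespace RadialOperator

variable {N : ℕ} {lam Lam gam del : ℝ} {F : ℝ → ℝ → ℝ → ℝ → ℝ → ℝ}

theorem radSol_zero_eq_zero (h : RadialOperator N lam Lam gam del F) {μ b r₀ : ℝ}
    {u u' u'' : ℝ → ℝ} (hu : RadSol F μ 0 b u u' u'') (hr₀ : r₀ ∈ Ioo 0 b) (h0 : u r₀ = 0)
    (h0' : u' r₀ = 0) : u 0 = 0 := by
  have hl := h.lam_pos
  have hg := h.gam_pos
  have hd := h.del_pos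
  have hL : 0 ≤ Lam * ((N : ℝ) - 1) := mul_nonneg (hl.le.trans h.lam_le) h.sub_one_nonneg
  have hzero : ∀ a ∈ Ioo 0 r₀, u a = 0 := by
    intro a ha
    have ha0 : 0 < a := ha.1
    obtain ⟨k, hk⟩ : ∃ k, k = (Lam * ((N : ℝ) - 1) / a + gam) / lam := ⟨_, rfl⟩
    obtain ⟨j, hj⟩ : ∃ j, j = (del + |μ|) / lam := ⟨_, rfl⟩
    have hk0 : 0 ≤ k := by rw [hk]; positivity
    have hj0 : 0 ≤ j := by rw [hj]; positivity
    have hsub : MapsTo (fun s : ℝ => -s) (Icc (-r₀) (-a)) (Icc 0 b) := fun s hs =>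
      ⟨by linarith [hs.2], by linarith [hs.1, hr₀.2]⟩
    have hsub' : ∀ s ∈ Ioo (-r₀) (-a), -s ∈ Ioo 0 b ∧ a ≤ -s := fun s hs =>
      ⟨⟨by linarith [hs.2], by linarith [hs.1, hr₀.2]⟩, by linarith [hs.2]⟩
    have := le_of_deriv_le_linear (f := fun s => u (-s) ^ 2 + u' (-s) ^ 2)
      (f' := fun s => -(2 * u (-s) * u' (-s) + 2 * u' (-s) * u'' (-s)))
      (C := 1 + 2 * k + j) (D := 0) (by positivity) le_rfl
      (((hu.1.continuousOn.comp continuousOn_neg hsub).pow 2).add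
        ((hu.1.2.1.comp continuousOn_neg hsub).pow 2)) ?_ ?_ (-a) ⟨by linarith [ha.2], le_rfl⟩
    · simp only [neg_neg, h0, h0', zero_mul, add_zero, ne_eq, OfNat.ofNat_ne_zero,
        not_false_eq_true, zero_pow] at this
      exact pow_eq_zero_iff two_ne_zero |>.1
        (le_antisymm (by linarith [sq_nonneg (u' a)]) (sq_nonneg (u a)))
    · intro s hs
      have hs' := (hsub' s hs).1
      have hneg : HasDerivAt (fun s : ℝ => -s) (-1) s := hasDerivAt_neg s
      refine (((hu.1.hasDerivAt hs').comp s hneg).pow 2 |>.add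
        (((hu.1.2.2.1 (-s) hs').comp s hneg).pow 2)).congr_deriv ?_
      simp only [Function.comp_apply, Nat.cast_ofNat]
      ring
    · intro s hs
      obtain ⟨hs', has⟩ := hsub' s hs
      generalize -s = r at hs' has
      have h1 := h.mul_abs_sub_le (u'' r) (u' r / r) (u' r) (u r) 0 0 0 0 r
      rw [h.map_zero, hu.2 r hs'] at h1
      simp only [sub_zero, abs_mul, abs_neg, abs_div, abs_of_pos hs'.1] at h1
      have h2 : |u' r| / r ≤ |u' r| / a := div_le_div_of_nonneg_left (abs_nonneg _) ha0 has
      have h3 : |u'' r| ≤ k * |u' r| + j * |u r| := by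
        have e : k * |u' r| + j * |u r| = (Lam * ((N : ℝ) - 1) * (|u' r| / a) + gam * |u' r| +
            del * |u r| + |μ| * |u r|) / lam := by
          rw [hk, hj]; field_simp; ring
        rw [e, le_div_iff₀ hl]
        linarith [mul_le_mul_of_nonneg_left h2 hL]
      have h4 : -(u r * u' r) ≤ |u r| * |u' r| := by
        rw [← abs_mul]; exact neg_le_abs _
      have h5 : -(u' r * u'' r) ≤ |u' r| * |u'' r| := by
        rw [← abs_mul]; exact neg_le_abs _
      have h6 := mul_le_mul_of_nonneg_left h3 (abs_nonneg (u' r))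
      rw [← sq_abs (u r), ← sq_abs (u' r)]
      nlinarith [sq_nonneg (|u r| - |u' r|), mul_nonneg hj0 (sq_nonneg (|u r| - |u' r|)),
        mul_nonneg hk0 (sq_nonneg |u r|)]
  have hlim : Tendsto u (𝓝[>] 0) (𝓝 (u 0)) := by
    have : ContinuousWithinAt u (Ioc 0 b) 0 :=
      (hu.1.continuousOn 0 ⟨le_rfl, (hr₀.1.trans hr₀.2).le⟩).mono Ioc_subset_Icc_self
    rw [ContinuousWithinAt, nhdsWithin_Ioc_eq_nhdsGT (hr₀.1.trans hr₀.2)] at this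
    exact this
  refine tendsto_nhds_unique hlim (tendsto_const_nhds.congr' ?_)
  filter_upwards [Ioo_mem_nhdsGT hr₀.1] with r hr using (hzero r hr).symm

theorem exists_subsolution (h : RadialOperator N lam Lam gam del F) {R' : ℝ} (hR' : 0 < R') :
    ∃ (μ : ℝ) (φ φ' φ'' : ℝ → ℝ), RadC2 0 R' φ φ' φ'' ∧ φ' 0 = 0 ∧ φ R' = 0 ∧
      (∀ r ∈ Ioo 0 R', 0 < φ r) ∧
      ∀ r ∈ Ioo 0 R', -μ * φ r ≤ F (φ'' r) (φ' r / r) (φ' r) (φ r) r := by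
  have hl := h.lam_pos
  have hg := h.gam_pos
  have hd := h.del_pos
  have hLam := h.lam_le
  have hN := h.sub_one_nonneg
  obtain ⟨c, hc⟩ : ∃ c, c = 8 * lam + 4 * Lam * N + 4 * gam * R' := ⟨_, rfl⟩
  have h1 : ∀ r, HasDerivAt (fun r => (R' ^ 2 - r ^ 2) ^ 2) (-4 * r * (R' ^ 2 - r ^ 2)) r := by
    intro r
    refine ((((hasDerivAt_id r).pow 2).const_sub (R' ^ 2)).pow 2).congr_deriv ?_
    simp only [Nat.cast_ofNat, Pi.pow_apply, id]
    ring
  have h2 : ∀ r, HasDerivAt (fun r => -4 * r * (R' ^ 2 - r ^ 2))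
      (8 * r ^ 2 - 4 * (R' ^ 2 - r ^ 2)) r := by
    intro r
    refine (((hasDerivAt_id r).const_mul (-4)).mul
      (((hasDerivAt_id r).pow 2).const_sub (R' ^ 2))).congr_deriv ?_
    simp only [Nat.cast_ofNat, Pi.pow_apply, id]
    ring
  refine ⟨del + c ^ 2 / (32 * lam * R' ^ 2), fun r => (R' ^ 2 - r ^ 2) ^ 2,
    fun r => -4 * r * (R' ^ 2 - r ^ 2), fun r => 8 * r ^ 2 - 4 * (R' ^ 2 - r ^ 2),
    ⟨fun r _ => (h1 r).hasDerivWithinAt, by fun_prop, fun r _ => h2 r, by fun_prop⟩,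
    by simp, by simp, fun r hr => ?_, fun r hr => ?_⟩
  · have : 0 < R' ^ 2 - r ^ 2 := by nlinarith [hr.1, hr.2]
    positivity
  · have hs : 0 < R' ^ 2 - r ^ 2 := by nlinarith [hr.1, hr.2]
    obtain ⟨s, hsdef⟩ : ∃ s, s = R' ^ 2 - r ^ 2 := ⟨_, rfl⟩
    simp only [← hsdef] at hs ⊢
    have hr0 := hr.1
    have e1 := h.lower (8 * r ^ 2 - 4 * s) (-4 * r * s / r) (-4 * r * s) (s ^ 2) 0 0 0 0 r
    have e2 := le_Pminus (m := 8 * r ^ 2 - 4 * s) (l := -4 * r * s / r) h.one_le hl hLam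
    rw [h.map_zero] at e1
    simp only [sub_zero] at e1
    have e3 : |-4 * r * s / r| = 4 * s := by
      rw [show -4 * r * s / r = -(4 * s) by field_simp, abs_neg, abs_of_pos (by positivity)]
    have e4 : |-4 * r * s| = 4 * r * s := by
      rw [show -4 * r * s = -(4 * r * s) by ring, abs_neg, abs_of_pos (by positivity)]
    rw [e3] at e2
    rw [e4, abs_of_nonneg (sq_nonneg s)] at e1
    have e5 : 8 * lam * r ^ 2 - 4 * Lam * s ≤
        lam * max (8 * r ^ 2 - 4 * s) 0 - Lam * max (-(8 * r ^ 2 - 4 * s)) 0 := by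
      rcases le_total 0 (8 * r ^ 2 - 4 * s) with hm | hm
      · rw [max_eq_left hm, max_eq_right (by linarith)]
        nlinarith
      · rw [max_eq_right hm, max_eq_left (by linarith)]
        nlinarith [sq_nonneg r]
    have e6 : gam * (4 * r * s) ≤ gam * (4 * R' * s) := by
      have := hr.2.le
      gcongr
    have e7 : 0 ≤ 8 * lam * R' ^ 2 - c * s + c ^ 2 / (32 * lam * R' ^ 2) * s ^ 2 := by
      have : 8 * lam * R' ^ 2 - c * s + c ^ 2 / (32 * lam * R' ^ 2) * s ^ 2 =
          (16 * lam * R' ^ 2 - c * s) ^ 2 / (32 * lam * R' ^ 2) := by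
        field_simp; ring
      rw [this]
      positivity
    have e8 : r ^ 2 = R' ^ 2 - s := by rw [hsdef]; ring
    rw [e8] at e1 e2 e5
    rw [hc] at e7 ⊢
    rw [e8]
    nlinarith

theorem radSol_pos_of_le (h : RadialOperator N lam Lam gam del F) {R' : ℝ} {u u' u'' : ℝ → ℝ}
    (hu : RadSol F (-del) 0 R' u u' u'') (hu0 : u 0 = 1) (hu0' : u' 0 = 0) :
    ∀ r ∈ Icc 0 R', 0 < u r := by
  by_contra! hcon
  obtain ⟨r₁, hr₁, hle⟩ := hcon
  have hK : IsCompact (Icc 0 R' ∩ u ⁻¹' Iic 0) :=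
    isCompact_Icc.of_isClosed_subset
      (hu.1.continuousOn.preimage_isClosed_of_isClosed isClosed_Icc isClosed_Iic) inter_subset_left
  obtain ⟨s, ⟨⟨hs, hus⟩, hmin⟩⟩ := hK.exists_isLeast ⟨r₁, hr₁, hle⟩
  have hus : u s ≤ 0 := hus
  have hs0 : 0 < s := by
    rcases hs.1.eq_or_lt with rfl | hlt
    · linarith
    · exact hlt
  have hu' := hu.mono (a' := 0) (b' := s) le_rfl hs.2
  have := h.pos_right hs0 (le_refl (-del)) hu'.1 (v := fun _ => 1) (v' := fun _ => 0)
    (v'' := fun _ => 0) ⟨fun r _ => hasDerivWithinAt_const _ _ _, continuousOn_const,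
      fun r _ => hasDerivAt_const _ _, continuousOn_const⟩ hu0' rfl ?_ (fun _ _ => one_pos)
      (fun r hr => (hu'.2 r hr).ge) ?_
  · linarith
  · intro r hr
    by_contra! hle
    exact absurd (hmin ⟨⟨hr.1.le, hr.2.le.trans hs.2⟩, hle⟩) (not_le.2 hr.2)
  · intro r hr
    have := h.upper 0 (0 / r) 0 1 0 0 0 0 r
    rw [h.map_zero] at this
    simpa [Pplus] using this

/-- Existence of the first eigenvalue, by shooting from the origin. -/
theorem exists_eigenvalue (h : RadialOperator N lam Lam gam del F) {R' : ℝ} (hR' : 0 < R') :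
    ∃ (μ : ℝ) (u u' u'' : ℝ → ℝ), RadEigenSol F R' μ u u' u'' ∧ ∀ r ∈ Ico 0 R', 0 < u r := by
  choose u u' u'' hsol hu0 hu0' using fun μ => h.exists_radSol μ hR'
  have hcont : ∀ μ, ∀ ε > 0, ∃ η > 0, ∀ ν, |ν - μ| < η → ∀ r ∈ Icc 0 R',
      |u ν r - u μ r| < ε := by
    intro μ ε hε
    obtain ⟨C, hC, hstab⟩ := h.exists_stability_bound (by positivity : 0 ≤ |μ| + 1)
    obtain ⟨M, hM⟩ := isCompact_Icc.exists_bound_of_continuousOn (hsol μ).1.continuousOn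
    obtain ⟨Q, hQ⟩ : ∃ Q, Q = C * M ^ 2 * R' * Real.exp (C * R') + 1 := ⟨_, rfl⟩
    have hQ0 : 0 < Q := by rw [hQ]; positivity
    refine ⟨min 1 (ε / √Q), lt_min one_pos (div_pos hε (Real.sqrt_pos.2 hQ0)), ?_⟩
    intro ν hν r hr
    have h1 : |ν - μ| < 1 := hν.trans_le (min_le_left _ _)
    have h2 : |ν - μ| < ε / √Q := hν.trans_le (min_le_right _ _)
    have h3 : |ν| ≤ |μ| + 1 := by linarith [abs_sub_abs_le_abs_sub ν μ]
    have h4 := hstab h3 le_rfl (hsol ν) (hsol μ) (fun r hr => hM r ⟨hr.1.le, hr.2.le⟩) r hr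
    rw [hu0, hu0, hu0', hu0'] at h4
    have h5 : (u ν r - u μ r) ^ 2 ≤ Q * (ν - μ) ^ 2 := by
      have : C * ((ν - μ) * M) ^ 2 * r * Real.exp (C * r) ≤
          C * ((ν - μ) * M) ^ 2 * R' * Real.exp (C * R') := by
        have h6 := hr.1
        have h7 := hr.2
        gcongr
      simp only [sub_self, ne_eq, OfNat.ofNat_ne_zero, not_false_eq_true, zero_pow, zero_add,
        sub_zero] at h4
      rw [hQ]
      nlinarith [sq_nonneg (u' ν r - u' μ r), sq_nonneg (ν - μ)]
    refine (Real.abs_le_sqrt h5).trans_lt ?_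
    rw [Real.sqrt_mul hQ0.le, Real.sqrt_sq_eq_abs]
    rwa [lt_div_iff₀ (Real.sqrt_pos.2 hQ0), mul_comm] at h2
  let S : Set ℝ := {μ | ∀ r ∈ Icc 0 R', 0 < u μ r}
  have hne : S.Nonempty := ⟨-del, h.radSol_pos_of_le (hsol _) (hu0 _) (hu0' _)⟩
  have hbdd : BddAbove S := by
    obtain ⟨μ₀, φ, φ', φ'', hφ, hφ0, hφR, hφp, hφs⟩ := h.exists_subsolution hR'
    refine ⟨μ₀, fun μ hμ => ?_⟩
    by_contra! hlt
    have := h.pos_right hR' hlt.le hφ (hsol μ).1 hφ0 (hu0' μ) hφp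
      (fun r hr => hμ r ⟨hr.1.le, hr.2⟩) hφs (fun r hr => ((hsol μ).2 r hr).le)
    linarith
  have hnn : ∀ r ∈ Icc 0 R', 0 ≤ u (sSup S) r := by
    intro r hr
    by_contra! hlt
    obtain ⟨η, hη, hclose⟩ := hcont (sSup S) (-u (sSup S) r) (by linarith)
    obtain ⟨ν, hνS, hν⟩ := exists_lt_of_lt_csSup hne (by linarith : sSup S - η < sSup S)
    have h1 : ν ≤ sSup S := le_csSup hbdd hνS
    have h2 := hclose ν (by rw [abs_lt]; constructor <;> linarith) r hr
    linarith [(abs_lt.1 h2).2, hνS r hr]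
  have hpos : ∀ r ∈ Ico 0 R', 0 < u (sSup S) r := by
    intro r hr
    refine (hnn r ⟨hr.1, hr.2.le⟩).lt_of_ne' fun h0 => ?_
    rcases hr.1.eq_or_lt with rfl | hr0
    · rw [hu0] at h0
      exact one_ne_zero h0
    · have hmin : IsLocalMin (u (sSup S)) r := by
        filter_upwards [Icc_mem_nhds hr0 hr.2] with x hx
        rw [h0]
        exact hnn x hx
      have h0' := hmin.hasDerivAt_eq_zero ((hsol _).1.hasDerivAt ⟨hr0, hr.2⟩)
      have := h.radSol_zero_eq_zero (hsol _) ⟨hr0, hr.2⟩ h0 h0'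
      rw [hu0] at this
      exact one_ne_zero this
  have hend : u (sSup S) R' = 0 := by
    by_contra hne0
    have hpos' : ∀ r ∈ Icc 0 R', 0 < u (sSup S) r := by
      intro r hr
      rcases hr.2.eq_or_lt with rfl | hlt
      · exact (hnn r hr).lt_of_ne' hne0
      · exact hpos r ⟨hr.1, hlt⟩
    obtain ⟨x, hx, hmin⟩ := isCompact_Icc.exists_isMinOn (nonempty_Icc.2 hR'.le)
      (hsol (sSup S)).1.continuousOn
    obtain ⟨η, hη, hclose⟩ := hcont (sSup S) (u (sSup S) x) (hpos' x hx)
    have hmem : sSup S + η / 2 ∈ S := by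
      intro r hr
      have h1 := hclose (sSup S + η / 2)
        (by rw [add_sub_cancel_left, abs_of_pos (half_pos hη)]; linarith) r hr
      have h2 : u (sSup S) x ≤ u (sSup S) r := hmin hr
      linarith [(abs_lt.1 h1).1]
    linarith [le_csSup hbdd hmem]
  exact ⟨sSup S, u _, u' _, u'' _, ⟨(hsol _).1, (hsol _).2, hu0' _, hend⟩, hpos⟩

/-- The first eigenvalue blows up on small balls. -/
theorem exists_forall_lt_eigenvalue (h : RadialOperator N lam Lam gam del F) (M : ℝ) :
    ∃ η : ℝ, 0 < η ∧ ∀ {R' μ : ℝ} {u u' u'' : ℝ → ℝ}, 0 < R' → R' < η →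
      RadEigenSol F R' μ u u' u'' → (∀ r ∈ Ioo 0 R', 0 < u r) → M < μ := by
  have hl := h.lam_pos
  have hg := h.gam_pos
  have hd := h.del_pos
  refine ⟨min 1 (lam / (gam + del + |M|)), lt_min one_pos (by positivity), ?_⟩
  intro R' μ u u' u'' hR' hlt hu hup
  by_contra! hle
  have h1 : R' < 1 := hlt.trans_le (min_le_left _ _)
  have h2 : R' * (gam + del + |M|) < lam :=
    (lt_div_iff₀ (by positivity)).1 (hlt.trans_le (min_le_right _ _))
  have hd1 : ∀ r, HasDerivAt (fun r => 2 * R' ^ 2 - r ^ 2) (-2 * r) r := by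
    intro r
    refine (((hasDerivAt_id r).pow 2).const_sub (2 * R' ^ 2)).congr_deriv ?_
    simp
  have hd2 : ∀ r : ℝ, HasDerivAt (fun r => -2 * r) (-2) r := by
    intro r
    simpa using (hasDerivAt_id r).const_mul (-2)
  have := h.pos_right hR' hle hu.1 (v := fun r => 2 * R' ^ 2 - r ^ 2) (v' := fun r => -2 * r)
    (v'' := fun _ => -2)
    ⟨fun r _ => (hd1 r).hasDerivWithinAt, by fun_prop, fun r _ => hd2 r, continuousOn_const⟩
    hu.2.2.1 (by simp) hup (fun r hr => by nlinarith [hr.1, hr.2])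
    (fun r hr => (hu.2.1 r hr).ge) ?_
  · linarith [hu.2.2.2]
  · intro r hr
    have hr0 := hr.1
    have hφ : 0 < 2 * R' ^ 2 - r ^ 2 := by nlinarith [hr.1, hr.2]
    have e1 := h.upper (-2) (-2 * r / r) (-2 * r) (2 * R' ^ 2 - r ^ 2) 0 0 0 0 r
    have e2 := Pplus_le_of_nonpos (Lam := Lam) (m := -2) (l := -2 * r / r) h.one_le hl (by norm_num)
      (by rw [mul_div_cancel_right₀ _ hr0.ne']; norm_num)
    rw [h.map_zero] at e1
    simp only [sub_zero] at e1
    rw [abs_of_pos hφ, abs_mul, abs_of_pos hr0, abs_neg, abs_two] at e1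
    have e3 : M * (2 * R' ^ 2 - r ^ 2) ≤ |M| * (2 * R' ^ 2) :=
      (mul_le_mul_of_nonneg_right (le_abs_self M) hφ.le).trans
        (mul_le_mul_of_nonneg_left (by nlinarith) (abs_nonneg M))
    have e4 : |M| * R' ^ 2 ≤ |M| * R' :=
      mul_le_mul_of_nonneg_left (by nlinarith) (abs_nonneg M)
    have e5 : del * (2 * R' ^ 2 - r ^ 2) ≤ del * (2 * R') :=
      mul_le_mul_of_nonneg_left (by nlinarith) hd.le
    have e6 : gam * (2 * r) ≤ gam * (2 * R') :=
      mul_le_mul_of_nonneg_left (by linarith [hr.2]) hg.le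
    linarith

/-- The dual operator `-F(-·)`, whose positive eigenfunctions are the negatives of the negative
eigenfunctions of `F`. -/
theorem dual (h : RadialOperator N lam Lam gam del F) :
    RadialOperator N lam Lam gam del fun m l p u r => -F (-m) (-l) (-p) (-u) r where
  one_le := h.one_le
  lam_pos := h.lam_pos
  lam_le := h.lam_le
  gam_pos := h.gam_pos
  del_pos := h.del_pos
  cont := (h.cont.comp (by fun_prop : Continuous fun z : ℝ × ℝ × ℝ × ℝ × ℝ =>
    (-z.1, -z.2.1, -z.2.2.1, -z.2.2.2.1, z.2.2.2.2))).neg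
  homog s hs m l p u r := by
    have := h.homog s hs (-m) (-l) (-p) (-u) r
    simp only [mul_neg] at this ⊢
    rw [this]
  lower m l p u m' l' p' u' r := by
    have := h.lower (-m') (-l') (-p') (-u') (-m) (-l) (-p) (-u) r
    simp only [neg_sub_neg] at this
    linarith
  upper m l p u m' l' p' u' r := by
    have := h.upper (-m') (-l') (-p') (-u') (-m) (-l) (-p) (-u) r
    simp only [neg_sub_neg] at this
    linarith

end RadialOperator

theorem RadEigenSol.neg_dual {F : ℝ → ℝ → ℝ → ℝ → ℝ → ℝ} {R' μ : ℝ} {u u' u'' : ℝ → ℝ}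
    (hu : RadEigenSol F R' μ u u' u'') :
    RadEigenSol (fun m l p u r => -F (-m) (-l) (-p) (-u) r) R' μ (fun r => -u r) (fun r => -u' r)
      fun r => -u'' r := by
  refine ⟨⟨fun r hr => (hu.1.1 r hr).neg, hu.1.2.1.neg, fun r hr => (hu.1.2.2.1 r hr).neg,
    hu.1.2.2.2.neg⟩, fun r hr => ?_, by simp [hu.2.2.1], by simp [hu.2.2.2]⟩
  have := hu.2.1 r hr
  simp only [neg_neg, ← neg_div, this]
  ring

theorem RadEigenSol.congr {F F' : ℝ → ℝ → ℝ → ℝ → ℝ → ℝ} {R' μ : ℝ} {u u' u'' : ℝ → ℝ}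
    (hu : RadEigenSol F R' μ u u' u'') (hF : ∀ r ∈ Ioo 0 R', ∀ m l p u, F' m l p u r = F m l p u r) :
    RadEigenSol F' R' μ u u' u'' :=
  ⟨hu.1, fun r hr => by rw [hF r hr]; exact hu.2.1 r hr, hu.2.2⟩

theorem RadialOperator.of_clamp {N : ℕ} {R lam Lam gam del : ℝ} (hN : 1 ≤ N) (hR : 0 ≤ R)
    (hlam : 0 < lam) (hLam : lam ≤ Lam) (hgam : 0 < gam) (hdel : 0 < del)
    {FF : ℝ → ℝ → ℝ → ℝ → ℝ → ℝ}
    (hFcont : ContinuousOn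
      (fun z : ℝ × ℝ × ℝ × ℝ × ℝ => FF z.1 z.2.1 z.2.2.1 z.2.2.2.1 z.2.2.2.2)
      {z : ℝ × ℝ × ℝ × ℝ × ℝ | z.2.2.2.2 ∈ Icc 0 R})
    (hF1 : ∀ s : ℝ, 0 ≤ s → ∀ m l p u : ℝ, ∀ r ∈ Icc (0 : ℝ) R,
      FF (s * m) (s * l) (s * p) (s * u) r = s * FF m l p u r)
    (hF2 : ∀ m l p u m' l' p' u' : ℝ, ∀ r ∈ Icc (0 : ℝ) R,
      Pminus N lam Lam (m - m') (l - l') - gam * |p - p'| - del * |u - u'|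
          ≤ FF m l p u r - FF m' l' p' u' r ∧
        FF m l p u r - FF m' l' p' u' r
          ≤ Pplus N lam Lam (m - m') (l - l') + gam * |p - p'| + del * |u - u'|) :
    RadialOperator N lam Lam gam del fun m l p u r => FF m l p u (max 0 (min r R)) := by
  have hmem : ∀ r, max 0 (min r R) ∈ Icc 0 R := fun r =>
    ⟨le_max_left _ _, max_le hR (min_le_right _ _)⟩
  refine ⟨hN, hlam, hLam, hgam, hdel, ?_, fun s hs m l p u r => hF1 s hs m l p u _ (hmem r),
    fun m l p u m' l' p' u' r => (hF2 m l p u m' l' p' u' _ (hmem r)).1,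
    fun m l p u m' l' p' u' r => (hF2 m l p u m' l' p' u' _ (hmem r)).2⟩
  exact hFcont.comp_continuous
    (f := fun z : ℝ × ℝ × ℝ × ℝ × ℝ =>
      (z.1, z.2.1, z.2.2.1, z.2.2.2.1, max 0 (min z.2.2.2.2 R)))
    (by fun_prop) fun z => hmem _

/-- the first radial semi-eigenvalues `λ⁺(R')`, `λ⁻(R')` in the balls of
radii `R' ∈ (0,R]`: existence of positive/negative eigenfunctions, `λ⁺ ≤ λ⁻`,
simplicity/uniqueness, strict monotonicity in `R'` and blow-up as `R' → 0⁺`. -/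
theorem stmt_18
    (N : ℕ) (hN : 1 ≤ N) (R lam Lam gam del : ℝ) (hR : 0 < R)
    (hlam : 0 < lam) (hLam : lam ≤ Lam) (hgam : 0 < gam) (hdel : 0 < del)
    (FF : ℝ → ℝ → ℝ → ℝ → ℝ → ℝ)
    (hFcont : ContinuousOn
      (fun z : ℝ × ℝ × ℝ × ℝ × ℝ => FF z.1 z.2.1 z.2.2.1 z.2.2.2.1 z.2.2.2.2)
      {z : ℝ × ℝ × ℝ × ℝ × ℝ | z.2.2.2.2 ∈ Icc 0 R})
    (hF1 : ∀ s : ℝ, 0 ≤ s → ∀ m l p u : ℝ, ∀ r ∈ Icc (0 : ℝ) R,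
      FF (s * m) (s * l) (s * p) (s * u) r = s * FF m l p u r)
    (hF2 : ∀ m l p u m' l' p' u' : ℝ, ∀ r ∈ Icc (0 : ℝ) R,
      Pminus N lam Lam (m - m') (l - l') - gam * |p - p'| - del * |u - u'|
          ≤ FF m l p u r - FF m' l' p' u' r ∧
        FF m l p u r - FF m' l' p' u' r
          ≤ Pplus N lam Lam (m - m') (l - l') + gam * |p - p'| + del * |u - u'|)
    (hF3 : ∀ m l p u m' l' p' u' : ℝ, ∀ r ∈ Icc (0 : ℝ) R,
      -FF (m' - m) (l' - l) (p' - p) (u' - u) r ≤ FF m l p u r - FF m' l' p' u' r ∧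
        FF m l p u r - FF m' l' p' u' r ≤ FF (m - m') (l - l') (p - p') (u - u') r)
    :
    ∃ lamP lamM : ℝ → ℝ,
      (∀ R' ∈ Ioc (0 : ℝ) R,
        -- existence
        (∃ u u' u'' : ℝ → ℝ, RadEigenSol FF R' (lamP R') u u' u'' ∧
          ∀ r ∈ Ico (0 : ℝ) R', 0 < u r) ∧
        (∃ u u' u'' : ℝ → ℝ, RadEigenSol FF R' (lamM R') u u' u'' ∧
          ∀ r ∈ Ico (0 : ℝ) R', u r < 0) ∧
        -- (i)
        lamP R' ≤ lamM R' ∧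
        -- (ii) uniqueness of the eigenvalue ...
        (∀ μ : ℝ, ∀ v v' v'' : ℝ → ℝ, RadEigenSol FF R' μ v v' v'' →
          (∀ r ∈ Ioo (0 : ℝ) R', 0 < v r) → μ = lamP R') ∧
        (∀ μ : ℝ, ∀ v v' v'' : ℝ → ℝ, RadEigenSol FF R' μ v v' v'' →
          (∀ r ∈ Ioo (0 : ℝ) R', v r < 0) → μ = lamM R') ∧
        -- ... and simplicity: any two positive (resp. negative) eigenfunctions are
        -- positive multiples of one another
        (∀ μ ν : ℝ, ∀ v v' v'' w w' w'' : ℝ → ℝ,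
          RadEigenSol FF R' μ v v' v'' → (∀ r ∈ Ioo (0 : ℝ) R', 0 < v r) →
          RadEigenSol FF R' ν w w' w'' → (∀ r ∈ Ioo (0 : ℝ) R', 0 < w r) →
          ∃ c : ℝ, 0 < c ∧ ∀ r ∈ Icc (0 : ℝ) R', v r = c * w r) ∧
        (∀ μ ν : ℝ, ∀ v v' v'' w w' w'' : ℝ → ℝ,
          RadEigenSol FF R' μ v v' v'' → (∀ r ∈ Ioo (0 : ℝ) R', v r < 0) →
          RadEigenSol FF R' ν w w' w'' → (∀ r ∈ Ioo (0 : ℝ) R', w r < 0) →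
          ∃ c : ℝ, 0 < c ∧ ∀ r ∈ Icc (0 : ℝ) R', v r = c * w r)) ∧
      -- (iii) strict monotonicity in the radius
      (∀ R'' R' : ℝ, 0 < R'' → R'' < R' → R' ≤ R →
        lamP R' < lamP R'' ∧ lamM R' < lamM R'') ∧
      -- (iv) blow-up as R' → 0⁺
      (∀ M : ℝ, ∃ η : ℝ, 0 < η ∧ ∀ R' ∈ Ioc (0 : ℝ) R, R' < η →
        M < lamP R' ∧ M < lamM R') := by

  obtain ⟨F, hF⟩ : ∃ F : ℝ → ℝ → ℝ → ℝ → ℝ → ℝ,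
    F = fun m l p u r => FF m l p u (max 0 (min r R)) := ⟨_, rfl⟩
  have h : RadialOperator N lam Lam gam del F := by
    rw [hF]
    exact RadialOperator.of_clamp hN hR.le hlam hLam hgam hdel hFcont hF1 hF2
  have hclamp : ∀ {R'}, R' ≤ R → ∀ r ∈ Ioo 0 R', ∀ m l p u, F m l p u r = FF m l p u r := by
    intro R' hR' r hr m l p u
    simp only [hF]
    rw [min_eq_left (hr.2.le.trans hR'), max_eq_right hr.1.le]
  have toF : ∀ {R' μ u u' u''}, R' ≤ R → RadEigenSol FF R' μ u u' u'' →
      RadEigenSol F R' μ u u' u'' := fun hR' hu => hu.congr (hclamp hR')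
  have ofF : ∀ {R' μ u u' u''}, R' ≤ R → RadEigenSol F R' μ u u' u'' →
      RadEigenSol FF R' μ u u' u'' :=
    fun hR' hu => hu.congr fun r hr m l p u => (hclamp hR' r hr m l p u).symm
  have posI : ∀ {R'} {u : ℝ → ℝ}, (∀ r ∈ Ico 0 R', 0 < u r) → ∀ r ∈ Ioo 0 R', 0 < u r :=
    fun hu r hr => hu r ⟨hr.1.le, hr.2⟩
  choose! lamP up up' up'' hup hup0 using
    fun (R' : ℝ) (hR' : 0 < R') => h.exists_eigenvalue hR'
  choose! lamM um um' um'' hum hum0 using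
    fun (R' : ℝ) (hR' : 0 < R') => h.dual.exists_eigenvalue hR'
  refine ⟨lamP, lamM, ?_, ?_, ?_⟩
  · rintro R' ⟨hR', hR'R⟩
    refine ⟨⟨_, _, _, ofF hR'R (hup R' hR'), hup0 R' hR'⟩, ?_, ?_, ?_, ?_, ?_, ?_⟩
    · refine ⟨_, _, _, ofF hR'R ((hum R' hR').neg_dual.congr fun r _ m l p u => ?_),
        fun r hr => neg_lt_zero.2 (hum0 R' hR' r hr)⟩
      simp only [neg_neg]
    · by_contra! hlt
      have hw := h.wronskian_pos_right hR' hlt (hum R' hR').1 (hup R' hR').1 (hum R' hR').2.2.1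
        (hup R' hR').2.2.1 (posI (hum0 R' hR')) (posI (hup0 R' hR')) (fun r hr => ?_)
        fun r hr => ((hup R' hR').2.1 r hr).le
      · rw [(hum R' hR').2.2.2, (hup R' hR').2.2.2] at hw
        simp at hw
      · have hrR : r ∈ Icc 0 R := ⟨hr.1.le, hr.2.le.trans hR'R⟩
        rw [← (hum R' hR').2.1 r hr]
        have h3 := (hF3 0 0 0 0 (um'' R' r) (um' R' r / r) (um' R' r) (um R' r) r hrR).2
        simp only [zero_sub] at h3
        rw [← hclamp hR'R r hr, ← hclamp hR'R r hr, ← hclamp hR'R r hr, h.map_zero] at h3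
        linarith
    · exact fun μ v v' v'' hv hvp =>
        h.eq_eigenvalue hR' (toF hR'R hv) (hup R' hR') hvp (posI (hup0 R' hR'))
    · exact fun μ v v' v'' hv hvn =>
        h.dual.eq_eigenvalue hR' (toF hR'R hv).neg_dual (hum R' hR')
          (fun r hr => neg_pos.2 (hvn r hr)) (posI (hum0 R' hR'))
    · exact fun μ ν v v' v'' w w' w'' hv hvp hw hwp =>
        h.exists_eq_mul hR' (toF hR'R hv) (toF hR'R hw) hvp hwp
    · intro μ ν v v' v'' w w' w'' hv hvn hw hwn
      obtain ⟨c, hc, hcv⟩ := h.dual.exists_eq_mul hR' (toF hR'R hv).neg_dual (toF hR'R hw).neg_dual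
        (fun r hr => neg_pos.2 (hvn r hr)) fun r hr => neg_pos.2 (hwn r hr)
      exact ⟨c, hc, fun r hr => by linarith [hcv r hr]⟩
  · intro R'' R' hR'' hlt _
    have hR' := hR''.trans hlt
    exact ⟨h.eigenvalue_strictAnti hR'' hlt (hup R' hR') (hup R'' hR'') (posI (hup0 R' hR'))
        (posI (hup0 R'' hR'')),
      h.dual.eigenvalue_strictAnti hR'' hlt (hum R' hR') (hum R'' hR'') (posI (hum0 R' hR'))
        (posI (hum0 R'' hR''))⟩
  · intro M
    obtain ⟨η₁, hη₁, h₁⟩ := h.exists_forall_lt_eigenvalue M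
    obtain ⟨η₂, hη₂, h₂⟩ := h.dual.exists_forall_lt_eigenvalue M
    exact ⟨min η₁ η₂, lt_min hη₁ hη₂, fun R' hR' hlt =>
      ⟨h₁ hR'.1 (hlt.trans_le (min_le_left _ _)) (hup R' hR'.1) (posI (hup0 R' hR'.1)),
        h₂ hR'.1 (hlt.trans_le (min_le_right _ _)) (hum R' hR'.1) (posI (hum0 R' hR'.1))⟩⟩
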